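/- arXiv:2509.17714 — 4 statements merged into one kernel-verified Lean document; each statement's English description precedes it below -/
import Mathlib

section
/- For all integers n ≥ 1 and k ≥ 4 there exist a full-dimensional integral polytope P ⊆ ℝ^{n+k} and a polynomial p of degree n+k with rational coefficients and constant coefficient 1 such that i(P,t) = p(t) for every positive integer t, the coefficient of t^j in p is positive for every j with n+3 ≤ j ≤ n+k−2, and the coefficient of t^j in p is negative for every j with 1 ≤ j ≤ n+2. -/
open scoped Pointwise BigOperators

/-- `P` is an integral polytope: the convex hull of finitely many points
with integer coordinates. -/
def IsIntegralPolytope {N : ℕ} (P : Set (Fin N → ℝ)) : Prop :=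
  ∃ V : Finset (Fin N → ℝ),
    (∀ v ∈ V, ∀ i, ∃ z : ℤ, v i = (z : ℝ)) ∧
    P = convexHull ℝ (V : Set (Fin N → ℝ))

/-- `latticeCount P t = i(P,t)`: the number of points of `ℤ^N` in the dilate `t • P`. -/
noncomputable def latticeCount {N : ℕ} (P : Set (Fin N → ℝ)) (t : ℕ) : ℕ :=
  Set.ncard {x : Fin N → ℝ | x ∈ (t : ℝ) • P ∧ ∀ i, ∃ z : ℤ, x i = (z : ℝ)}

open Polynomial

/-- `p` is the Ehrhart polynomial of some full-dimensional integral polytope in `ℝ^N`. -/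
def IsEhrhartPolynomial (N : ℕ) (p : ℚ[X]) : Prop :=
  ∃ P : Set (Fin N → ℝ), IsIntegralPolytope P ∧ (interior P).Nonempty ∧
    ∀ t : ℕ, 0 < t → (latticeCount P t : ℚ) = p.eval (t : ℚ)

theorem ncard_integers_smul_Icc (l : ℕ) {t : ℕ} (ht : 0 < t) :
    {x : ℝ | x ∈ (t : ℝ) • Set.Icc (0 : ℝ) l ∧ ∃ z : ℤ, x = z}.ncard = t * l + 1 := by
  have h : {x : ℝ | x ∈ (t : ℝ) • Set.Icc (0 : ℝ) l ∧ ∃ z : ℤ, x = z} =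
      (Nat.cast : ℕ → ℝ) '' (Finset.range (t * l + 1) : Set ℕ) := by
    ext x
    have hs : (t : ℝ) • Set.Icc (0 : ℝ) l = Set.Icc 0 (t * l : ℝ) := by
      simp [LinearOrderedField.smul_Icc (show (0 : ℝ) < t by exact_mod_cast ht)]
    simp only [hs, Set.mem_ofPred_eq, Set.mem_Icc, Set.mem_image, Finset.coe_range, Set.mem_Iio]
    constructor
    · rintro ⟨⟨h0, h1⟩, z, rfl⟩
      have hz : 0 ≤ z := by exact_mod_cast h0
      lift z to ℕ using hz
      refine ⟨z, ?_, by simp⟩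
      have : z ≤ t * l := by exact_mod_cast h1
      omega
    · rintro ⟨m, hm, rfl⟩
      refine ⟨⟨by positivity, ?_⟩, m, by simp⟩
      exact_mod_cast Nat.le_of_lt_succ hm
  rw [h, Set.ncard_image_of_injective _ Nat.cast_injective, Set.ncard_coe_finset, Finset.card_range]

theorem IsEhrhartPolynomial.mul_segment {N : ℕ} {p : ℚ[X]} (hp : IsEhrhartPolynomial N p)
    {l : ℕ} (hl : 0 < l) : IsEhrhartPolynomial (N + 1) (p * (1 + C (l : ℚ) * X)) := by
  classical
  obtain ⟨P, ⟨V, hV, rfl⟩, hint, hcount⟩ := hp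
  set P := convexHull ℝ (V : Set (Fin N → ℝ))
  set e := Fin.consEquivL ℝ (fun _ : Fin (N + 1) => ℝ)
  have he0 (y : ℝ × (Fin N → ℝ)) : e y 0 = y.1 := rfl
  have hes (y : ℝ × (Fin N → ℝ)) (i : Fin N) : e y i.succ = y.2 i := rfl
  refine ⟨e '' (Set.Icc (0 : ℝ) l ×ˢ P), ⟨(({0, (l : ℝ)} : Finset ℝ) ×ˢ V).image e, ?_, ?_⟩, ?_, ?_⟩
  · intro v hv
    obtain ⟨y, hy, rfl⟩ := Finset.mem_image.1 hv
    rw [Finset.mem_product] at hy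
    refine Fin.cases ?_ fun i => ?_
    · rw [he0]
      rcases Finset.mem_insert.1 hy.1 with h | h
      · exact ⟨0, by simp [h]⟩
      · exact ⟨l, by simp [Finset.mem_singleton.1 h]⟩
    · rw [hes]
      exact hV _ hy.2 i
  · have h := (e.toLinearEquiv.toLinearMap).image_convexHull
      (({0, (l : ℝ)} : Set ℝ) ×ˢ (V : Set (Fin N → ℝ)))
    rw [convexHull_prod, convexHull_pair, segment_eq_Icc (by positivity)] at h
    rw [Finset.coe_image, Finset.coe_product, Finset.coe_pair]
    exact h
  · have h := e.toHomeomorph.image_interior (Set.Icc (0 : ℝ) l ×ˢ P)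
    rw [ContinuousLinearEquiv.coe_toHomeomorph] at h
    rw [← h, interior_prod_eq, interior_Icc]
    refine Set.Nonempty.image _ (Set.Nonempty.prod ?_ hint)
    exact Set.nonempty_Ioo.2 (by positivity)
  · intro t ht
    have h : {x : Fin (N + 1) → ℝ | x ∈ (t : ℝ) • (e '' (Set.Icc (0 : ℝ) l ×ˢ P)) ∧
        ∀ i, ∃ z : ℤ, x i = z} =
        e '' ({x : ℝ | x ∈ (t : ℝ) • Set.Icc (0 : ℝ) l ∧ ∃ z : ℤ, x = z} ×ˢ
          {x : Fin N → ℝ | x ∈ (t : ℝ) • P ∧ ∀ i, ∃ z : ℤ, x i = z}) := by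
      rw [← image_smul_set, Set.smul_set_prod]
      ext x
      constructor
      · rintro ⟨⟨y, hy, rfl⟩, hx⟩
        exact ⟨y, ⟨⟨hy.1, hx 0⟩, hy.2, fun i => hx i.succ⟩, rfl⟩
      · rintro ⟨y, hy, rfl⟩
        exact ⟨⟨y, ⟨hy.1.1, hy.2.1⟩, rfl⟩, Fin.cases hy.1.2 hy.2.2⟩
    rw [latticeCount, h, Set.ncard_image_of_injective _ e.injective, Set.ncard_prod,
      ncard_integers_smul_Icc l ht]
    have := hcount t ht
    rw [latticeCount] at this
    simp only [Nat.cast_mul, this, eval_mul, eval_add, eval_one, eval_C, eval_X,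
      Nat.cast_add, Nat.cast_one]
    ring

theorem IsEhrhartPolynomial.mul_cube {N : ℕ} {p : ℚ[X]} (hp : IsEhrhartPolynomial N p)
    {l : ℕ} (hl : 0 < l) (m : ℕ) :
    IsEhrhartPolynomial (N + m) (p * (1 + C (l : ℚ) * X) ^ m) := by
  induction m with
  | zero => simpa using hp
  | succ m ih => simpa [pow_succ, mul_assoc, add_assoc] using ih.mul_segment hl

theorem IsEhrhartPolynomial.exists_affineSpan_eq_top {N : ℕ} {p : ℚ[X]}
    (hp : IsEhrhartPolynomial N p) :
    ∃ P : Set (Fin N → ℝ), IsIntegralPolytope P ∧ affineSpan ℝ P = ⊤ ∧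
      ∀ t : ℕ, 0 < t → (latticeCount P t : ℚ) = p.eval (t : ℚ) := by
  obtain ⟨P, hP, hint, h⟩ := hp
  refine ⟨P, hP, ?_, h⟩
  obtain ⟨V, -, rfl⟩ := hP
  exact (convex_convexHull ℝ _).interior_nonempty_iff_affineSpan_eq_top.1 hint

theorem boxPoly_coeff (n d l j : ℕ) :
    ((1 + C l * X) ^ n * (1 + X) ^ d : ℕ[X]).coeff j =
      ∑ a ∈ Finset.range (j + 1), n.choose a * l ^ a * d.choose (j - a) := by
  have h : ((1 + C l * X) ^ n : ℕ[X]) = ((1 + X) ^ n : ℕ[X]).comp (C l * X) := by simp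
  rw [coeff_mul, Finset.Nat.sum_antidiagonal_eq_sum_range_succ
    (fun a b => ((1 + C l * X) ^ n : ℕ[X]).coeff a * ((1 + X) ^ d : ℕ[X]).coeff b)]
  refine Finset.sum_congr rfl fun a _ => ?_
  rw [h, comp_C_mul_X_coeff, coeff_one_add_X_pow, coeff_one_add_X_pow]
  simp

theorem boxPoly_coeff_pos {n d l j : ℕ} (hl : 0 < l) (hj : j ≤ n + d) :
    0 < ((1 + C l * X) ^ n * (1 + X) ^ d : ℕ[X]).coeff j := by
  rw [boxPoly_coeff]
  refine Finset.sum_pos' (fun _ _ => Nat.zero_le _) ⟨min j n, by simp, ?_⟩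
  have h1 : 0 < n.choose (min j n) := Nat.choose_pos (by omega)
  have h2 : 0 < d.choose (j - min j n) := Nat.choose_pos (by omega)
  positivity

theorem choose_add_two_le (d i : ℕ) : d.choose (i + 2) ≤ 2 ^ d * d.choose i := by
  by_cases h : i ≤ d
  · calc d.choose (i + 2) ≤ 2 ^ d := Nat.choose_le_two_pow d _
      _ ≤ 2 ^ d * d.choose i := Nat.le_mul_of_pos_right _ (Nat.choose_pos h)
  · rw [Nat.choose_eq_zero_of_lt (by omega)]; exact Nat.zero_le _

theorem boxPoly_coeff_add_two_lt {n d l j : ℕ} (hd : 1 ≤ d) (hl : 0 < l) (hj : n ≤ j)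
    (hj' : j ≤ n + d) :
    ((1 + C l * X) ^ n * (1 + X) ^ d : ℕ[X]).coeff (j + 2) <
      (2 ^ d) ^ 2 * ((1 + C l * X) ^ n * (1 + X) ^ d : ℕ[X]).coeff j := by
  have hpos := boxPoly_coeff_pos hl hj'
  have hle : ((1 + C l * X) ^ n * (1 + X) ^ d : ℕ[X]).coeff (j + 2) ≤
      2 ^ d * ((1 + C l * X) ^ n * (1 + X) ^ d : ℕ[X]).coeff j := by
    rw [boxPoly_coeff, boxPoly_coeff, Finset.sum_range_succ, Finset.sum_range_succ,
      Nat.choose_eq_zero_of_lt (show n < j + 1 by omega),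
      Nat.choose_eq_zero_of_lt (show n < j + 2 by omega), Finset.mul_sum]
    simp only [zero_mul, add_zero]
    refine Finset.sum_le_sum fun a ha => ?_
    rw [Finset.mem_range] at ha
    rw [show j + 2 - a = j - a + 2 by omega]
    calc n.choose a * l ^ a * d.choose (j - a + 2)
        ≤ n.choose a * l ^ a * (2 ^ d * d.choose (j - a)) :=
          Nat.mul_le_mul_left _ (choose_add_two_le _ _)
      _ = _ := by ring
  refine hle.trans_lt (Nat.mul_lt_mul_of_pos_right ?_ hpos)
  have : 1 < 2 ^ d := Nat.one_lt_two_pow (by omega)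
  nlinarith

theorem boxPoly_coeff_le {n d l : ℕ} (hl : 0 < l) (j : ℕ) :
    ((1 + C l * X) ^ n * (1 + X) ^ d : ℕ[X]).coeff j ≤ 2 ^ (n + d) * l ^ j := by
  rw [boxPoly_coeff]
  calc _ ≤ ∑ a ∈ Finset.range (j + 1), n.choose a * d.choose (j - a) * l ^ j := by
        refine Finset.sum_le_sum fun a ha => ?_
        rw [Finset.mem_range] at ha
        calc n.choose a * l ^ a * d.choose (j - a) = n.choose a * d.choose (j - a) * l ^ a := by
              ring
          _ ≤ _ := Nat.mul_le_mul_left _ (Nat.pow_le_pow_right hl (by omega))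
    _ = (n + d).choose j * l ^ j := by
        rw [Nat.add_choose_eq, Finset.Nat.sum_antidiagonal_eq_sum_range_succ
          (fun a b => n.choose a * d.choose b), Finset.sum_mul]
    _ ≤ _ := Nat.mul_le_mul_right _ (Nat.choose_le_two_pow _ _)

theorem boxPoly_coeff_lt_add_two {n d l j : ℕ} (hd : 1 ≤ d)
    (hl : (2 ^ d) ^ 2 * 2 ^ (n + d) < l) (hj : j + 1 ≤ n) :
    (2 ^ d) ^ 2 * ((1 + C l * X) ^ n * (1 + X) ^ d : ℕ[X]).coeff j <
      ((1 + C l * X) ^ n * (1 + X) ^ d : ℕ[X]).coeff (j + 2) := by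
  have hl0 : 0 < l := by omega
  calc _ ≤ (2 ^ d) ^ 2 * (2 ^ (n + d) * l ^ j) := Nat.mul_le_mul_left _ (boxPoly_coeff_le hl0 j)
    _ = ((2 ^ d) ^ 2 * 2 ^ (n + d)) * l ^ j := by ring
    _ < l * l ^ j := Nat.mul_lt_mul_of_pos_right hl (by positivity)
    _ = 1 * l ^ (j + 1) * 1 := by ring
    _ ≤ n.choose (j + 1) * l ^ (j + 1) * d.choose (j + 2 - (j + 1)) := by
        have h1 : 1 ≤ n.choose (j + 1) := Nat.choose_pos hj
        have h2 : 1 ≤ d.choose (j + 2 - (j + 1)) := Nat.choose_pos (by omega)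
        gcongr
    _ ≤ _ := by
        rw [boxPoly_coeff]
        exact Finset.single_le_sum (f := fun a => n.choose a * l ^ a * d.choose (j + 2 - a))
          (fun _ _ => Nat.zero_le _) (by simp : j + 1 ∈ Finset.range (j + 2 + 1))

/-- Ehrhart polynomial of the `c`-th dilate of the Reeve tetrahedron of height `6 * Q`. -/
noncomputable def reevePoly (c Q : ℕ) : ℚ[X] :=
  1 + C ((2 - Q) * c : ℚ) * X + C (c ^ 2 : ℚ) * X ^ 2 + C (Q * c ^ 3 : ℚ) * X ^ 3

theorem reevePoly_mul_coeff (c Q : ℕ) (F : ℚ[X]) (j : ℕ) :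
    (reevePoly c Q * F).coeff (j + 3) = F.coeff (j + 3) + (2 - Q) * c * F.coeff (j + 2) +
      c ^ 2 * F.coeff (j + 1) + Q * c ^ 3 * F.coeff j := by
  simp only [reevePoly, add_mul, one_mul, mul_assoc, coeff_add, coeff_C_mul, pow_succ,
    pow_zero, coeff_X_mul]

theorem reevePoly_mul_coeff_one (c Q : ℕ) (F : ℚ[X]) :
    (reevePoly c Q * F).coeff 1 = F.coeff 1 + (2 - Q) * c * F.coeff 0 := by
  have h : (X * F).coeff 1 = F.coeff 0 := coeff_X_mul F 0
  simp only [reevePoly, add_mul, one_mul, mul_assoc, coeff_add, coeff_C_mul, h, coeff_X_pow_mul']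
  norm_num

theorem reevePoly_mul_coeff_two (c Q : ℕ) (F : ℚ[X]) :
    (reevePoly c Q * F).coeff 2 = F.coeff 2 + (2 - Q) * c * F.coeff 1 + c ^ 2 * F.coeff 0 := by
  have h : (X * F).coeff 2 = F.coeff 1 := coeff_X_mul F 1
  simp only [reevePoly, add_mul, one_mul, mul_assoc, coeff_add, coeff_C_mul, h, coeff_X_pow_mul']
  norm_num

theorem exists_coeff_signs (n d : ℕ) (hd : 1 ≤ d) :
    ∃ c l Q : ℕ, 0 < c ∧ 0 < l ∧ 0 < Q ∧
      (∀ j, n + 3 ≤ j → j ≤ n + d + 1 →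
        0 < (reevePoly c Q * ((1 + C (l : ℚ) * X) ^ n * (1 + X) ^ d)).coeff j) ∧
      (∀ j, 1 ≤ j → j ≤ n + 2 →
        (reevePoly c Q * ((1 + C (l : ℚ) * X) ^ n * (1 + X) ^ d)).coeff j < 0) := by
  set c := 2 ^ d with hc
  obtain ⟨l, hl⟩ : ∃ l, c ^ 2 * 2 ^ (n + d) < l := ⟨_, Nat.lt_succ_self _⟩
  have hc0 : 0 < c := by positivity
  have hl0 : 0 < l := by omega
  set F : ℕ[X] := (1 + C l * X) ^ n * (1 + X) ^ d with hF
  have hmap : ((1 + C (l : ℚ) * X) ^ n * (1 + X) ^ d : ℚ[X]) = F.map (Nat.castRingHom ℚ) := by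
    simp [hF]
  have hlow (i : ℕ) (hi : i + 1 ≤ n) : c ^ 2 * F.coeff i + 1 ≤ F.coeff (i + 2) :=
    boxPoly_coeff_lt_add_two hd hl hi
  have hhigh (i : ℕ) (hi : n ≤ i) (hi' : i ≤ n + d) : F.coeff (i + 2) + 1 ≤ c ^ 2 * F.coeff i :=
    boxPoly_coeff_add_two_lt hd hl0 hi hi'
  have hF0 : 1 ≤ F.coeff 0 := boxPoly_coeff_pos hl0 (by omega)
  have hF1 : 1 ≤ F.coeff 1 := boxPoly_coeff_pos hl0 (by omega)
  -- `Q` exceeds the part of each low coefficient that does not involve `Q`.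
  obtain ⟨Q, hQ0, hQ⟩ : ∃ Q : ℕ, 0 < Q ∧ ∀ j ≤ n + 2,
      F.coeff j + 2 * c * F.coeff (j - 1) + c ^ 2 * F.coeff (j - 2) < Q := by
    refine ⟨∑ j ∈ Finset.range (n + 3),
      (F.coeff j + 2 * c * F.coeff (j - 1) + c ^ 2 * F.coeff (j - 2)) + 1, by omega,
      fun j hj => Nat.lt_succ_of_le ?_⟩
    exact Finset.single_le_sum
      (f := fun j => F.coeff j + 2 * c * F.coeff (j - 1) + c ^ 2 * F.coeff (j - 2))
      (fun _ _ => Nat.zero_le _) (Finset.mem_range.2 (by omega))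
  have hc1 : (1 : ℚ) ≤ c := by exact_mod_cast hc0
  have hQc : (Q : ℚ) ≤ Q * c := le_mul_of_one_le_right (by positivity) hc1
  refine ⟨c, l, Q, hc0, hl0, hQ0, fun j h1 h2 => ?_, fun j h1 h2 => ?_⟩
  · obtain ⟨i, rfl⟩ : ∃ i, j = i + 3 := ⟨j - 3, by omega⟩
    rw [hmap, reevePoly_mul_coeff]
    simp only [coeff_map, eq_natCast]
    have h : ((F.coeff (i + 2) : ℕ) : ℚ) + 1 ≤ c ^ 2 * F.coeff i := by
      exact_mod_cast hhigh i (by omega) (by omega)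
    have hQc0 : (0 : ℚ) < Q * c := by positivity
    have h3 : (0 : ℚ) ≤ F.coeff (i + 3) + 2 * c * F.coeff (i + 2) + c ^ 2 * F.coeff (i + 1) := by
      positivity
    nlinarith [mul_le_mul_of_nonneg_left h hQc0.le]
  · have hq := hQ j h2
    rw [hmap]
    obtain rfl | rfl | ⟨i, rfl⟩ : j = 1 ∨ j = 2 ∨ ∃ i, j = i + 3 := by
      rcases Nat.lt_or_ge j 3 with h | h
      · omega
      · exact Or.inr (Or.inr ⟨j - 3, by omega⟩)
    · rw [reevePoly_mul_coeff_one]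
      simp only [coeff_map, eq_natCast]
      replace hq : (F.coeff 1 : ℚ) + 2 * c * F.coeff 0 + c ^ 2 * F.coeff 0 < Q := by
        exact_mod_cast hq
      have h : (1 : ℚ) ≤ F.coeff 0 := by exact_mod_cast hF0
      have h0 : (0 : ℚ) ≤ c ^ 2 * F.coeff 0 := by positivity
      nlinarith [mul_le_mul_of_nonneg_left h (show (0 : ℚ) ≤ Q * c by positivity)]
    · rw [reevePoly_mul_coeff_two]
      simp only [coeff_map, eq_natCast]
      replace hq : (F.coeff 2 : ℚ) + 2 * c * F.coeff 1 + c ^ 2 * F.coeff 0 < Q := by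
        exact_mod_cast hq
      have h : (1 : ℚ) ≤ F.coeff 1 := by exact_mod_cast hF1
      nlinarith [mul_le_mul_of_nonneg_left h (show (0 : ℚ) ≤ Q * c by positivity)]
    · rw [reevePoly_mul_coeff]
      simp only [coeff_map, eq_natCast]
      replace hq : (F.coeff (i + 3) : ℚ) + 2 * c * F.coeff (i + 2) + c ^ 2 * F.coeff (i + 1) <
          Q := by
        exact_mod_cast hq
      have h : (c : ℚ) ^ 2 * F.coeff i + 1 ≤ F.coeff (i + 2) := by
        exact_mod_cast hlow i (by omega)
      nlinarith [mul_le_mul_of_nonneg_left h (show (0 : ℚ) ≤ Q * c by positivity)]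

theorem reevePoly_mul_natDegree {c l Q : ℕ} (n d : ℕ) (hc : 0 < c) (hl : 0 < l) (hQ : 0 < Q) :
    (reevePoly c Q * ((1 + C (l : ℚ) * X) ^ n * (1 + X) ^ d)).natDegree = 3 + n + d := by
  have h1 : (reevePoly c Q).natDegree = 3 := by
    unfold reevePoly
    compute_degree!
    omega
  have h2 : (1 + C (l : ℚ) * X).natDegree = 1 := by
    compute_degree!
    omega
  have h3 : (1 + X : ℚ[X]).natDegree = 1 := by compute_degree!
  have h0 (p : ℚ[X]) (m : ℕ) (h : p.natDegree = m + 1) : p ≠ 0 := by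
    rintro rfl; simp at h
  rw [natDegree_mul (h0 _ _ h1)
      (mul_ne_zero (pow_ne_zero _ (h0 _ _ h2)) (pow_ne_zero _ (h0 _ _ h3))),
    natDegree_mul (pow_ne_zero _ (h0 _ _ h2)) (pow_ne_zero _ (h0 _ _ h3)),
    natDegree_pow, natDegree_pow, h1, h2, h3]
  ring

/-- The inequality description of the `r`-th dilate of the Reeve tetrahedron of height `q`. -/
def reeveRegion (q r : ℝ) : Set (Fin 3 → ℝ) :=
  {x | 0 ≤ x 2 ∧ x 2 ≤ q * x 0 ∧ x 2 ≤ q * x 1 ∧ q * (x 0 + x 1) - x 2 ≤ q * r}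

theorem convex_reeveRegion (q r : ℝ) : Convex ℝ (reeveRegion q r) := by
  rintro x ⟨h1, h2, h3, h4⟩ y ⟨k1, k2, k3, k4⟩ a b ha hb hab
  simp only [reeveRegion, Set.mem_ofPred_eq, Pi.add_apply, Pi.smul_apply, smul_eq_mul]
  have hr : q * r = a * (q * r) + b * (q * r) := by rw [← add_mul, hab, one_mul]
  refine ⟨by positivity, ?_, ?_, ?_⟩
  · linarith [mul_le_mul_of_nonneg_left h2 ha, mul_le_mul_of_nonneg_left k2 hb]
  · linarith [mul_le_mul_of_nonneg_left h3 ha, mul_le_mul_of_nonneg_left k3 hb]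
  · linarith [mul_le_mul_of_nonneg_left h4 ha, mul_le_mul_of_nonneg_left k4 hb]

theorem reeveRegion_eq_convexHull {q r : ℝ} (hq : 0 < q) (hr : 0 < r) :
    reeveRegion q r =
      convexHull ℝ {![0, 0, 0], ![r, 0, 0], ![0, r, 0], ![r, r, r * q]} := by
  apply Set.Subset.antisymm
  · rintro x ⟨h1, h2, h3, h4⟩
    have hz : x 2 / q * q = x 2 := div_mul_cancel₀ _ hq.ne'
    set w : Fin 4 → ℝ := ![1 - (x 0 + x 1 - x 2 / q) / r, (x 0 - x 2 / q) / r,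
      (x 1 - x 2 / q) / r, x 2 / q / r] with hw
    set v : Fin 4 → (Fin 3 → ℝ) := ![![0, 0, 0], ![r, 0, 0], ![0, r, 0], ![r, r, r * q]] with hv
    have hx : ∑ i, w i • v i = x := by
      ext j
      fin_cases j <;> simp [Fin.sum_univ_four, hw, hv] <;> field_simp <;> ring
    rw [← hx]
    refine (convex_convexHull ℝ _).sum_mem (fun i _ => ?_) ?_ fun i _ => subset_convexHull ℝ _ ?_
    · fin_cases i
      · have : (x 0 + x 1 - x 2 / q) / r ≤ 1 := by
          rw [div_le_one hr]
          refine le_of_mul_le_mul_left ?_ hq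
          linarith
        simpa [hw] using this
      · have : 0 ≤ x 0 - x 2 / q := by
          rw [sub_nonneg, div_le_iff₀ hq]; linarith
        simpa [hw] using div_nonneg this hr.le
      · have : 0 ≤ x 1 - x 2 / q := by
          rw [sub_nonneg, div_le_iff₀ hq]; linarith
        simpa [hw] using div_nonneg this hr.le
      · simpa [hw] using div_nonneg (div_nonneg h1 hq.le) hr.le
    · simp only [Fin.sum_univ_four, hw]
      simp
      field_simp
      ring
    · fin_cases i <;> simp [hv]
  · refine convexHull_min ?_ (convex_reeveRegion q r)
    rintro x (rfl | rfl | rfl | rfl) <;> simp [reeveRegion] <;>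
      first | positivity | (refine ⟨?_, ?_, ?_⟩ <;> nlinarith [mul_pos hq hr])

theorem smul_reeveRegion {q r t : ℝ} (ht : 0 < t) :
    t • reeveRegion q r = reeveRegion q (t * r) := by
  ext x
  rw [Set.mem_smul_set_iff_inv_smul_mem₀ ht.ne']
  simp only [reeveRegion, Set.mem_ofPred_eq, Pi.smul_apply, smul_eq_mul]
  have h (a b : ℝ) : t⁻¹ * a ≤ b ↔ a ≤ t * b := inv_mul_le_iff₀ ht
  have e1 : 0 ≤ t⁻¹ * x 2 ↔ 0 ≤ x 2 := mul_nonneg_iff_of_pos_left (inv_pos.2 ht)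
  have e2 (i : Fin 3) : t⁻¹ * x 2 ≤ q * (t⁻¹ * x i) ↔ x 2 ≤ q * x i := by
    rw [h]; field_simp
  have e4 : q * (t⁻¹ * x 0 + t⁻¹ * x 1) - t⁻¹ * x 2 ≤ q * r ↔
      q * (x 0 + x 1) - x 2 ≤ q * (t * r) := by
    rw [show q * (t⁻¹ * x 0 + t⁻¹ * x 1) - t⁻¹ * x 2 = t⁻¹ * (q * (x 0 + x 1) - x 2) by ring, h]
    ring_nf
  rw [e1, e2, e2, e4]

theorem interior_reeveRegion_nonempty {q r : ℝ} (hq : 0 < q) (hr : 0 < r) :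
    (interior (reeveRegion q r)).Nonempty := by
  refine ⟨![r / 4 + r / 8, r / 4 + r / 8, q * r / 4], mem_interior.2
    ⟨{x | 0 < x 2 ∧ x 2 < q * x 0 ∧ x 2 < q * x 1 ∧ q * (x 0 + x 1) - x 2 < q * r}, ?_, ?_, ?_⟩⟩
  · rintro x ⟨h1, h2, h3, h4⟩
    exact ⟨h1.le, h2.le, h3.le, h4.le⟩
  · refine IsOpen.and ?_ (IsOpen.and ?_ (IsOpen.and ?_ ?_)) <;>
      exact isOpen_lt (by fun_prop) (by fun_prop)
  · have := mul_pos hq hr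
    simp
    refine ⟨by linarith, by linarith, by linarith⟩

/-- Parameters `(u, w, x, y)` of the lattice points `(u + [w > 0] + x, u + [w > 0] + y, q * u + w)`
of the `s`-th dilate of the Reeve tetrahedron of height `q`. -/
def reeveParam (q s : ℕ) : Finset (Σ _ : ℕ, Σ _ : ℕ, Σ _ : ℕ, ℕ) :=
  (Finset.range (s + 1)).sigma fun u => (Finset.range q).sigma fun w =>
    (Finset.range (s + 1 - u)).sigma fun x =>
      Finset.range (if w = 0 then s + 1 - u - x else s + 1 - u - 2 - x)

theorem sum_range_sub_eq_sum_range_succ (f : ℕ → ℚ) (m : ℕ) :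
    ∑ u ∈ Finset.range m, f (m - u) = ∑ u ∈ Finset.range m, f (u + 1) := by
  rw [← Finset.sum_range_reflect]
  refine Finset.sum_congr rfl fun u hu => ?_
  rw [Finset.mem_range] at hu
  congr 1
  omega

theorem card_reeveParam {q : ℕ} (hq : 0 < q) (s : ℕ) :
    ((reeveParam q s).card : ℚ) =
      (s + 1) * (s + 2) * (s + 3) / 6 + (q - 1) * ((s + 1) * s * (s - 1) / 6) := by
  obtain ⟨q, rfl⟩ : ∃ k, q = k + 1 := ⟨q - 1, by omega⟩
  have h1 (m : ℕ) : ∑ x ∈ Finset.range m, ((m - x : ℕ) : ℚ) = m * (m + 1) / 2 := by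
    rw [sum_range_sub_eq_sum_range_succ (fun a => (a : ℚ))]
    induction m with
    | zero => simp
    | succ m ih => rw [Finset.sum_range_succ, ih]; push_cast; ring
  have h2 (m : ℕ) : ∑ x ∈ Finset.range (m + 1), ((m + 1 - 2 - x : ℕ) : ℚ) = m * (m - 1) / 2 := by
    have (x : ℕ) : m + 1 - 2 - x = m + 1 - x - 2 := by omega
    simp only [this]
    rw [sum_range_sub_eq_sum_range_succ (fun a => ((a - 2 : ℕ) : ℚ))]
    induction m with
    | zero => simp
    | succ m ih =>
      rw [Finset.sum_range_succ, ih (fun _ => by omega)]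
      simp; ring
  have h3 (s : ℕ) : ∑ u ∈ Finset.range (s + 1),
      (((s + 1 - u : ℕ) : ℚ) * ((s + 1 - u : ℕ) + 1) / 2) =
      (s + 1) * (s + 2) * (s + 3) / 6 := by
    rw [sum_range_sub_eq_sum_range_succ (fun a => (a : ℚ) * (a + 1) / 2)]
    induction s with
    | zero => norm_num
    | succ s ih => rw [Finset.sum_range_succ, ih]; push_cast; ring
  have h4 (s : ℕ) : ∑ u ∈ Finset.range (s + 1),
      ∑ x ∈ Finset.range (s + 1 - u), ((s + 1 - u - 2 - x : ℕ) : ℚ) =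
        (s + 1) * s * (s - 1) / 6 := by
    rw [sum_range_sub_eq_sum_range_succ
      (fun a => ∑ x ∈ Finset.range a, ((a - 2 - x : ℕ) : ℚ))]
    simp only [h2]
    induction s with
    | zero => simp
    | succ s ih => rw [Finset.sum_range_succ, ih]; push_cast; ring
  simp only [reeveParam, Finset.card_sigma, Finset.card_range, Finset.sum_range_succ' _ q]
  simp only [Nat.succ_ne_zero, if_true, if_false, Finset.sum_const, Finset.card_range, nsmul_eq_mul,
    Nat.cast_sum, Nat.cast_add, Nat.cast_mul, Finset.sum_add_distrib, ← Finset.mul_sum, h4, h1, h3]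
  push_cast
  ring

theorem ncard_integers_reeveRegion {q : ℕ} (hq : 0 < q) (s : ℕ) :
    {x : Fin 3 → ℝ | x ∈ reeveRegion q s ∧ ∀ i, ∃ z : ℤ, x i = z}.ncard =
      (reeveParam q s).card := by
  rw [← Set.ncard_coe_finset]
  symm
  refine Set.ncard_congr (fun a _ => ![((a.1 + (if a.2.1 = 0 then 0 else 1) + a.2.2.1 : ℕ) : ℝ),
    ((a.1 + (if a.2.1 = 0 then 0 else 1) + a.2.2.2 : ℕ) : ℝ), ((q * a.1 + a.2.1 : ℕ) : ℝ)])
    ?_ ?_ ?_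
  · rintro ⟨u, w, x, y⟩ h
    simp only [reeveParam, Finset.mem_coe, Finset.mem_sigma, Finset.mem_range] at h
    obtain ⟨hu, hw, hx, hy⟩ := h
    refine ⟨?_, fun i => ?_⟩
    · simp only [reeveRegion, Set.mem_ofPred_eq, Matrix.cons_val]
      rw [sub_le_iff_le_add]
      norm_cast
      split_ifs at hy ⊢ with h0
      · subst h0
        refine ⟨Nat.zero_le _, by nlinarith, by nlinarith, ?_⟩
        have : 2 * u + x + y ≤ s + u := by omega
        nlinarith
      · refine ⟨Nat.zero_le _, by nlinarith, by nlinarith, ?_⟩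
        have : 2 * (u + 1) + x + y ≤ s + u := by omega
        nlinarith
    · fin_cases i
      · exact ⟨((u + (if w = 0 then 0 else 1) + x : ℕ) : ℤ), by simp⟩
      · exact ⟨((u + (if w = 0 then 0 else 1) + y : ℕ) : ℤ), by simp⟩
      · exact ⟨((q * u + w : ℕ) : ℤ), by simp⟩
  · rintro ⟨u, w, x, y⟩ ⟨u', w', x', y'⟩ h h' heq
    simp only [reeveParam, Finset.mem_coe, Finset.mem_sigma, Finset.mem_range] at h h'
    have e0 := congrFun heq 0
    have e1 := congrFun heq 1
    have e2 := congrFun heq 2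
    simp only [Matrix.cons_val, Nat.cast_inj] at e0 e1 e2
    have hu : u = u' := by
      have := congrArg (· / q) e2
      simpa [Nat.mul_add_div hq, Nat.div_eq_of_lt h.2.1, Nat.div_eq_of_lt h'.2.1] using this
    subst hu
    obtain rfl : w = w' := by omega
    obtain rfl : x = x' := by omega
    obtain rfl : y = y' := by omega
    rfl
  · rintro v ⟨⟨h1, h2, h3, h4⟩, hv⟩
    obtain ⟨x, hx⟩ := hv 0
    obtain ⟨y, hy⟩ := hv 1
    obtain ⟨z, hz⟩ := hv 2
    rw [hx] at h2 h4
    rw [hy] at h3 h4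
    rw [hz] at h1 h2 h3 h4
    norm_cast at h1 h2 h3 h4
    have hq' : (0 : ℤ) < q := by exact_mod_cast hq
    have hx0 : 0 ≤ x := by nlinarith
    have hy0 : 0 ≤ y := by nlinarith
    lift x to ℕ using hx0
    lift y to ℕ using hy0
    lift z to ℕ using h1
    have hdiv := Nat.div_add_mod z q
    have hmod := Nat.mod_lt z hq
    set u := z / q
    set w := z % q
    rw [← hdiv] at h2 h3 h4
    push_cast at h2 h3 h4
    have hw0 : (0 : ℤ) ≤ w := by positivity
    have hmod' : (w : ℤ) < q := by exact_mod_cast hmod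
    have hsum : (x : ℤ) + y ≤ s + u := by
      have : (x : ℤ) + y < s + u + 1 := lt_of_mul_lt_mul_left (by linarith) hq'.le
      omega
    by_cases h0 : w = 0
    · have hux : (u : ℤ) ≤ x := le_of_mul_le_mul_left (by linarith) hq'
      have huy : (u : ℤ) ≤ y := le_of_mul_le_mul_left (by linarith) hq'
      refine ⟨⟨u, w, x - u, y - u⟩, ?_, ?_⟩
      · simp only [reeveParam, Finset.mem_coe, Finset.mem_sigma, Finset.mem_range, h0, if_true]
        omega
      · ext i
        fin_cases i
        · simp only [h0, if_true, Fin.zero_eta, Matrix.cons_val, hx, Int.cast_natCast, Nat.cast_inj]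
          omega
        · simp only [h0, if_true, Fin.mk_one, Matrix.cons_val, hy, Int.cast_natCast, Nat.cast_inj]
          omega
        · simp only [Fin.reduceFinMk, Matrix.cons_val, hz, Int.cast_natCast, Nat.cast_inj]
          omega
    · have hw1 : (0 : ℤ) < w := by omega
      have hux : (u : ℤ) < x := lt_of_mul_lt_mul_left (by linarith) hq'.le
      have huy : (u : ℤ) < y := lt_of_mul_lt_mul_left (by linarith) hq'.le
      refine ⟨⟨u, w, x - u - 1, y - u - 1⟩, ?_, ?_⟩
      · simp only [reeveParam, Finset.mem_coe, Finset.mem_sigma, Finset.mem_range, h0, if_false]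
        omega
      · ext i
        fin_cases i
        · simp only [h0, if_false, Fin.zero_eta, Matrix.cons_val, hx, Int.cast_natCast, Nat.cast_inj]
          omega
        · simp only [h0, if_false, Fin.mk_one, Matrix.cons_val, hy, Int.cast_natCast, Nat.cast_inj]
          omega
        · simp only [Fin.reduceFinMk, Matrix.cons_val, hz, Int.cast_natCast, Nat.cast_inj]
          omega

theorem isEhrhartPolynomial_reevePoly {c Q : ℕ} (hc : 0 < c) (hQ : 0 < Q) :
    IsEhrhartPolynomial 3 (reevePoly c Q) := by
  classical
  have hq : (0 : ℝ) < (6 * Q : ℕ) := by positivity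
  have hc' : (0 : ℝ) < c := by positivity
  refine ⟨reeveRegion (6 * Q : ℕ) c, ⟨({![0, 0, 0], ![(c : ℝ), 0, 0], ![0, (c : ℝ), 0],
    ![(c : ℝ), c, c * (6 * Q : ℕ)]} : Finset (Fin 3 → ℝ)), ?_, ?_⟩,
    interior_reeveRegion_nonempty hq hc', fun t ht => ?_⟩
  · intro v hv
    simp only [Finset.mem_insert, Finset.mem_singleton] at hv
    rcases hv with rfl | rfl | rfl | rfl
    · exact fun i => ⟨(![0, 0, 0] : Fin 3 → ℤ) i, by fin_cases i <;> simp⟩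
    · exact fun i => ⟨(![(c : ℤ), 0, 0] : Fin 3 → ℤ) i, by fin_cases i <;> simp⟩
    · exact fun i => ⟨(![0, (c : ℤ), 0] : Fin 3 → ℤ) i, by fin_cases i <;> simp⟩
    · exact fun i => ⟨(![(c : ℤ), c, c * (6 * Q : ℕ)] : Fin 3 → ℤ) i, by fin_cases i <;> simp⟩
  · rw [reeveRegion_eq_convexHull hq hc']
    simp
  · have h := ncard_integers_reeveRegion (show 0 < 6 * Q by omega) (t * c)
    rw [Nat.cast_mul t c] at h
    rw [latticeCount, smul_reeveRegion (by exact_mod_cast ht), h, card_reeveParam (by omega)]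
    simp [reevePoly]
    ring


theorem more_positive (n k : ℕ) (hn : 1 ≤ n) (hk : 4 ≤ k) :
    ∃ (P : Set (Fin (n + k) → ℝ)) (p : Polynomial ℚ),
      IsIntegralPolytope P ∧ affineSpan ℝ P = ⊤ ∧
      p.natDegree = n + k ∧ p.coeff 0 = 1 ∧
      (∀ t : ℕ, 0 < t → (latticeCount P t : ℚ) = p.eval (t : ℚ)) ∧
      (∀ j : ℕ, n + 3 ≤ j → j ≤ n + k - 2 → 0 < p.coeff j) ∧
      (∀ j : ℕ, 1 ≤ j → j ≤ n + 2 → p.coeff j < 0) := by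
  obtain ⟨d, rfl⟩ : ∃ d, k = d + 3 := ⟨k - 3, by omega⟩
  obtain ⟨c, l, Q, hc, hl, hQ, hpos, hneg⟩ := exists_coeff_signs n d (by omega)
  have hE := ((isEhrhartPolynomial_reevePoly hc hQ).mul_cube hl n).mul_cube one_pos d
  rw [show 3 + n + d = n + (d + 3) by omega, Nat.cast_one, C_1, one_mul, mul_assoc] at hE
  obtain ⟨P, hP, hspan, hcount⟩ := hE.exists_affineSpan_eq_top
  refine ⟨P, _, hP, hspan, ?_, ?_, hcount, fun j h1 h2 => hpos j h1 (by omega), hneg⟩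
  · rw [reevePoly_mul_natDegree n d hc hl hQ]
    omega
  · simp [coeff_zero_eq_eval_zero, reevePoly]
end

section
/- For all positive integers β and d with d ≥ β + 2 there exist a full-dimensional integral polytope P ⊆ ℝ^d and a polynomial p of degree d with rational coefficients and constant coefficient 1 such that i(P,t) = p(t) for every positive integer t, the coefficient of t^j in p is positive for every j with d−β−1 ≤ j ≤ d−2, and the coefficient of t^j in p is negative for every j with 1 ≤ j ≤ d−β−2. -/
open scoped Pointwise BigOperators

/-- The product of `[0, n]^D` with the pyramid of apex `(k, k, m * k)` over the square `[0, 2k]^2`. -/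
def pyramidPrism (D : ℕ) (k n m : ℝ) : Set (Fin (D + 3) → ℝ) :=
  {x | 0 ≤ x 2 ∧ x 2 ≤ m * x 0 ∧ x 2 ≤ m * x 1 ∧ x 2 ≤ m * (2 * k - x 0) ∧
    x 2 ≤ m * (2 * k - x 1) ∧ ∀ i : Fin D, 0 ≤ x i.succ.succ.succ ∧ x i.succ.succ.succ ≤ n}

theorem forall_fin_add_three {D : ℕ} {p : Fin (D + 3) → Prop} :
    (∀ i, p i) ↔ p 0 ∧ p 1 ∧ p 2 ∧ ∀ i : Fin D, p i.succ.succ.succ := by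
  rw [Fin.forall_fin_succ, Fin.forall_fin_succ, Fin.forall_fin_succ]
  rfl

theorem convex_pyramidPrism (D : ℕ) (k n m : ℝ) : Convex ℝ (pyramidPrism D k n m) := by
  rintro x ⟨h0, h1, h2, h3, h4, h5⟩ y ⟨g0, g1, g2, g3, g4, g5⟩ a b ha hb hab
  obtain rfl : b = 1 - a := by linarith
  simp only [pyramidPrism, Set.mem_ofPred_eq, Pi.add_apply, Pi.smul_apply, smul_eq_mul]
  refine ⟨by positivity, ?_, ?_, ?_, ?_, fun i => ⟨?_, ?_⟩⟩
  · nlinarith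
  · nlinarith
  · nlinarith
  · nlinarith
  · have := (h5 i).1; have := (g5 i).1; positivity
  · nlinarith [mul_le_mul_of_nonneg_left (h5 i).2 ha, mul_le_mul_of_nonneg_left (g5 i).2 hb]

theorem smul_pyramidPrism (D : ℕ) (k n m : ℝ) {t : ℝ} (ht : 0 < t) :
    t • pyramidPrism D k n m = pyramidPrism D (t * k) (t * n) m := by
  ext x
  rw [Set.mem_smul_set_iff_inv_smul_mem₀ ht.ne']
  simp only [pyramidPrism, Set.mem_ofPred_eq, Pi.smul_apply, smul_eq_mul]
  have key (a b : ℝ) : t⁻¹ * a ≤ b ↔ a ≤ t * b := by rw [inv_mul_le_iff₀ ht]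
  have pos (a : ℝ) : 0 ≤ t⁻¹ * a ↔ 0 ≤ a := by
    rw [mul_nonneg_iff_of_pos_left (inv_pos.2 ht)]
  have e (a : ℝ) : t * (m * (t⁻¹ * a)) = m * a := by field_simp
  have e' (a : ℝ) : t * (m * (2 * k - t⁻¹ * a)) = m * (2 * (t * k) - a) := by field_simp
  simp only [key, pos, e, e']

theorem isIntegralPolytope_pyramidPrism (D : ℕ) {k n m : ℕ} (hk : 0 < k) (hm : 0 < m) :
    IsIntegralPolytope (pyramidPrism D k n m) := by
  have hk' : (0 : ℝ) < k := by exact_mod_cast hk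
  have hm' : (0 : ℝ) < m := by exact_mod_cast hm
  have hn' : (0 : ℝ) ≤ n := Nat.cast_nonneg n
  let S : Fin (D + 3) → Set ℝ :=
    Fin.cons {0, 2 * (k : ℝ)} (Fin.cons {0, 2 * (k : ℝ)} (Fin.cons {0} fun _ => {0, (n : ℝ)}))
  let T : Fin (D + 3) → Set ℝ :=
    Fin.cons {(k : ℝ)} (Fin.cons {(k : ℝ)} (Fin.cons {(m * k : ℝ)} fun _ => {0, (n : ℝ)}))
  have hS : (Set.univ.pi S).Finite := by
    refine Set.Finite.pi' (t := S) ?_ |>.subset fun x hx i => hx i trivial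
    rw [forall_fin_add_three]
    exact ⟨Set.toFinite {0, 2 * (k : ℝ)}, Set.toFinite {0, 2 * (k : ℝ)},
      Set.toFinite {(0 : ℝ)}, fun _ => Set.toFinite {0, (n : ℝ)}⟩
  have hT : (Set.univ.pi T).Finite := by
    refine Set.Finite.pi' (t := T) ?_ |>.subset fun x hx i => hx i trivial
    rw [forall_fin_add_three]
    exact ⟨Set.toFinite {(k : ℝ)}, Set.toFinite {(k : ℝ)},
      Set.toFinite {(m * k : ℝ)}, fun _ => Set.toFinite {0, (n : ℝ)}⟩
  have memS (x : Fin (D + 3) → ℝ) : x ∈ Set.univ.pi S ↔ (x 0 = 0 ∨ x 0 = 2 * k) ∧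
      (x 1 = 0 ∨ x 1 = 2 * k) ∧ x 2 = 0 ∧
        ∀ i : Fin D, x i.succ.succ.succ = 0 ∨ x i.succ.succ.succ = n := by
    rw [Set.mem_univ_pi, forall_fin_add_three]; rfl
  have memT (x : Fin (D + 3) → ℝ) : x ∈ Set.univ.pi T ↔ x 0 = k ∧ x 1 = k ∧ x 2 = m * k ∧
        ∀ i : Fin D, x i.succ.succ.succ = 0 ∨ x i.succ.succ.succ = n := by
    rw [Set.mem_univ_pi, forall_fin_add_three]; rfl
  have hullS (x : Fin (D + 3) → ℝ) (h0 : 0 ≤ x 0 ∧ x 0 ≤ 2 * k) (h1 : 0 ≤ x 1 ∧ x 1 ≤ 2 * k)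
      (h2 : x 2 = 0) (h3 : ∀ i : Fin D, 0 ≤ x i.succ.succ.succ ∧ x i.succ.succ.succ ≤ n) :
      x ∈ convexHull ℝ (Set.univ.pi S) := by
    rw [convexHull_pi, Set.mem_univ_pi, forall_fin_add_three]
    have key (a b : ℝ) (hb : 0 ≤ b) (h : 0 ≤ a ∧ a ≤ b) : a ∈ convexHull ℝ {0, b} := by
      rw [convexHull_pair, segment_eq_Icc hb]; exact h
    refine ⟨key _ _ (by positivity) h0, key _ _ (by positivity) h1, ?_,
      fun i => key _ _ hn' (h3 i)⟩
    exact subset_convexHull _ _ h2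
  have hullT (x : Fin (D + 3) → ℝ) (h0 : x 0 = k) (h1 : x 1 = k)
      (h2 : x 2 = m * k) (h3 : ∀ i : Fin D, 0 ≤ x i.succ.succ.succ ∧ x i.succ.succ.succ ≤ n) :
      x ∈ convexHull ℝ (Set.univ.pi T) := by
    rw [convexHull_pi, Set.mem_univ_pi, forall_fin_add_three]
    have key (a b : ℝ) (hb : 0 ≤ b) (h : 0 ≤ a ∧ a ≤ b) : a ∈ convexHull ℝ {0, b} := by
      rw [convexHull_pair, segment_eq_Icc hb]; exact h
    exact ⟨subset_convexHull _ _ h0, subset_convexHull _ _ h1, subset_convexHull _ _ h2,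
      fun i => key _ _ hn' (h3 i)⟩
  refine ⟨(hS.union hT).toFinset, ?_, ?_⟩
  · intro v hv
    rw [Set.Finite.mem_toFinset, Set.mem_union, memS, memT] at hv
    rw [forall_fin_add_three]
    have int0 : ∃ z : ℤ, (0 : ℝ) = z := ⟨0, by simp⟩
    have intk : ∃ z : ℤ, (k : ℝ) = z := ⟨k, by simp⟩
    have int2k : ∃ z : ℤ, (2 * k : ℝ) = z := ⟨2 * k, by simp⟩
    have intmk : ∃ z : ℤ, (m * k : ℝ) = z := ⟨m * k, by simp⟩
    have intn : ∃ z : ℤ, (n : ℝ) = z := ⟨n, by simp⟩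
    rcases hv with ⟨h0, h1, h2, h3⟩ | ⟨h0, h1, h2, h3⟩
    · refine ⟨?_, ?_, by rwa [h2], fun i => ?_⟩
      · rcases h0 with h | h <;> rwa [h]
      · rcases h1 with h | h <;> rwa [h]
      · rcases h3 i with h | h <;> rwa [h]
    · refine ⟨by rwa [h0], by rwa [h1], by rwa [h2], fun i => ?_⟩
      rcases h3 i with h | h <;> rwa [h]
  · rw [Set.Finite.coe_toFinset]
    apply Set.Subset.antisymm
    · rintro x ⟨h0, h1, h2, h3, h4, h5⟩
      have h0x : x 2 / m ≤ x 0 := by rw [div_le_iff₀ hm']; linarith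
      have h1x : x 2 / m ≤ x 1 := by rw [div_le_iff₀ hm']; linarith
      have h0y : x 2 / m ≤ 2 * k - x 0 := by rw [div_le_iff₀ hm']; linarith
      have h1y : x 2 / m ≤ 2 * k - x 1 := by rw [div_le_iff₀ hm']; linarith
      set s : ℝ := x 2 / m / k with hs
      have hsk : x 2 / m = s * k := by rw [hs]; field_simp
      have hx2 : x 2 = s * (m * k) := by rw [hs]; field_simp
      rw [hsk] at h0x h1x h0y h1y
      have hs0 : 0 ≤ s := by positivity
      have hs1 : s ≤ 1 := by
        have : s * k ≤ 1 * k := by linarith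
        exact le_of_mul_le_mul_right this hk'
      rcases hs1.eq_or_lt with h | h
      · rw [h] at h0x h1x h0y h1y hx2
        exact convexHull_mono Set.subset_union_right
          (hullT x (by linarith) (by linarith) (by linarith) h5)
      · have hpos : 0 < 1 - s := by linarith
        let u : Fin (D + 3) → ℝ := Fin.cons ((x 0 - s * k) / (1 - s))
          (Fin.cons ((x 1 - s * k) / (1 - s)) (Fin.cons 0 fun i => x i.succ.succ.succ))
        let v : Fin (D + 3) → ℝ := Fin.cons (k : ℝ)
          (Fin.cons (k : ℝ) (Fin.cons (m * k : ℝ) fun i => x i.succ.succ.succ))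
        have hu : u ∈ convexHull ℝ (Set.univ.pi S) := by
          refine hullS u ⟨?_, ?_⟩ ⟨?_, ?_⟩ rfl h5
          · exact div_nonneg (by linarith) hpos.le
          · change (x 0 - s * k) / (1 - s) ≤ _
            rw [div_le_iff₀ hpos]; linarith
          · exact div_nonneg (by linarith) hpos.le
          · change (x 1 - s * k) / (1 - s) ≤ _
            rw [div_le_iff₀ hpos]; linarith
        have hv : v ∈ convexHull ℝ (Set.univ.pi T) := hullT v rfl rfl rfl h5
        have hx : x = (1 - s) • u + s • v := by
          rw [funext_iff, forall_fin_add_three]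
          refine ⟨?_, ?_, ?_, fun i => ?_⟩
          · change x 0 = (1 - s) * ((x 0 - s * k) / (1 - s)) + s * k
            field_simp; ring
          · change x 1 = (1 - s) * ((x 1 - s * k) / (1 - s)) + s * k
            field_simp; ring
          · change x 2 = (1 - s) * 0 + s * (m * k)
            linarith
          · change _ = (1 - s) * x i.succ.succ.succ + s * x i.succ.succ.succ
            ring
        rw [hx]
        exact convex_convexHull ℝ _ (convexHull_mono Set.subset_union_left hu)
          (convexHull_mono Set.subset_union_right hv) hpos.le hs0 (by ring)
    · refine convexHull_min ?_ (convex_pyramidPrism D k n m)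
      have hn (a : ℝ) (h : a = 0 ∨ a = n) : 0 ≤ a ∧ a ≤ n := by
        rcases h with rfl | rfl <;> simp [hn']
      rintro x (hx | hx)
      · obtain ⟨h0, h1, h2, h3⟩ := (memS x).1 hx
        refine ⟨h2.ge, ?_, ?_, ?_, ?_, fun i => hn _ (h3 i)⟩ <;> rw [h2] <;>
        apply mul_nonneg hm'.le
        · rcases h0 with h | h <;> rw [h]; positivity
        · rcases h1 with h | h <;> rw [h]; positivity
        · rcases h0 with h | h <;> rw [h] <;> linarith
        · rcases h1 with h | h <;> rw [h] <;> linarith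
      · obtain ⟨h0, h1, h2, h3⟩ := (memT x).1 hx
        refine ⟨?_, ?_, ?_, ?_, ?_, fun i => hn _ (h3 i)⟩ <;> simp only [h0, h1, h2]
        · positivity
        all_goals linarith

theorem affineSpan_pyramidPrism (D : ℕ) {k n m : ℝ} (hk : 0 < k) (hn : 0 < n) (hm : 0 < m) :
    affineSpan ℝ (pyramidPrism D k n m) = ⊤ := by
  let U : Set (Fin (D + 3) → ℝ) :=
    {x | 0 < x 2 ∧ x 2 < m * x 0 ∧ x 2 < m * x 1 ∧ x 2 < m * (2 * k - x 0) ∧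
      x 2 < m * (2 * k - x 1) ∧ ∀ i : Fin D, 0 < x i.succ.succ.succ ∧ x i.succ.succ.succ < n}
  have hU : IsOpen U := by
    have hw : IsOpen {x : Fin (D + 3) → ℝ |
        ∀ i : Fin D, 0 < x i.succ.succ.succ ∧ x i.succ.succ.succ < n} := by
      simp only [Set.ofPred_forall]
      exact isOpen_iInter_of_finite fun i =>
        (isOpen_lt (by fun_prop) (by fun_prop)).and (isOpen_lt (by fun_prop) (by fun_prop))
    refine (isOpen_lt ?_ ?_).and <| (isOpen_lt ?_ ?_).and <| (isOpen_lt ?_ ?_).and <|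
      (isOpen_lt ?_ ?_).and <| (isOpen_lt ?_ ?_).and hw <;> fun_prop
  have hne : U.Nonempty := by
    refine ⟨Fin.cons k (Fin.cons k (Fin.cons (m * k / 2) fun _ => n / 2)), ?_⟩
    have : 0 < m * k := by positivity
    change 0 < m * k / 2 ∧ m * k / 2 < m * k ∧ m * k / 2 < m * k ∧ m * k / 2 < m * (2 * k - k) ∧
      m * k / 2 < m * (2 * k - k) ∧ ∀ i : Fin D, 0 < n / 2 ∧ n / 2 < n
    refine ⟨?_, ?_, ?_, ?_, ?_, fun i => ⟨?_, ?_⟩⟩ <;> linarith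
  rw [eq_top_iff, ← hU.affineSpan_eq_top hne]
  refine affineSpan_mono ℝ ?_
  rintro x ⟨h0, h1, h2, h3, h4, h5⟩
  exact ⟨h0.le, h1.le, h2.le, h3.le, h4.le, fun i => ⟨(h5 i).1.le, (h5 i).2.le⟩⟩

/-- The height over `(a, b)` of the pyramid of apex `(k, k, k)` over the square `[0, 2k]^2`. -/
def squareDepth (k a b : ℕ) : ℕ := min (min a b) (min (2 * k - a) (2 * k - b))

theorem le_mul_squareDepth {k m a b c : ℕ} : c ≤ m * squareDepth k a b ↔
    c ≤ m * a ∧ c ≤ m * b ∧ c ≤ m * (2 * k - a) ∧ c ≤ m * (2 * k - b) := by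
  simp only [squareDepth, ← Nat.mul_min_mul_left, le_min_iff, and_assoc]

theorem squareDepth_succ {k a b : ℕ} (ha : a ≤ 2 * k) (hb : b ≤ 2 * k) :
    squareDepth (k + 1) (a + 1) (b + 1) = squareDepth k a b + 1 := by
  unfold squareDepth; omega

theorem sum_squareDepth (k : ℕ) :
    3 * (∑ a ∈ Finset.range (2 * k + 1), ∑ b ∈ Finset.range (2 * k + 1), squareDepth k a b) + k =
      4 * k ^ 3 := by
  induction k with
  | zero => simp [squareDepth]
  | succ k ih =>
    have left (b : ℕ) : squareDepth (k + 1) 0 b = 0 := by unfold squareDepth; omega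
    have right (b : ℕ) : squareDepth (k + 1) (2 * k + 1 + 1) b = 0 := by
      unfold squareDepth; omega
    have bot (a : ℕ) : squareDepth (k + 1) a 0 = 0 := by unfold squareDepth; omega
    have top (a : ℕ) : squareDepth (k + 1) a (2 * k + 1 + 1) = 0 := by
      unfold squareDepth; omega
    have inner : ∑ a ∈ Finset.range (2 * k + 1), ∑ b ∈ Finset.range (2 * k + 1),
        squareDepth (k + 1) (a + 1) (b + 1) =
        (∑ a ∈ Finset.range (2 * k + 1), ∑ b ∈ Finset.range (2 * k + 1), squareDepth k a b) +
          (2 * k + 1) * (2 * k + 1) := by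
      rw [Finset.sum_congr rfl fun a ha => Finset.sum_congr rfl fun b hb =>
        squareDepth_succ (Finset.mem_range_succ_iff.1 ha) (Finset.mem_range_succ_iff.1 hb)]
      simp [Finset.sum_add_distrib]
    rw [show 2 * (k + 1) + 1 = 2 * k + 1 + 1 + 1 by ring, Finset.sum_range_succ,
      Finset.sum_range_succ']
    simp only [left, right, Finset.sum_const_zero, add_zero]
    simp only [Finset.sum_range_succ _ (2 * k + 1 + 1), Finset.sum_range_succ' _ (2 * k + 1),
      bot, top, add_zero]
    rw [inner]
    linarith

theorem exists_nat_of_nonneg_of_int {r : ℝ} (h : 0 ≤ r) (hz : ∃ z : ℤ, r = z) :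
    ∃ a : ℕ, r = a := by
  obtain ⟨z, rfl⟩ := hz
  lift z to ℕ using by exact_mod_cast h
  exact ⟨z, by simp⟩

theorem ncard_pyramidPrism (D : ℕ) {k n m : ℕ} (hm : 0 < m) :
    Set.ncard {x : Fin (D + 3) → ℝ | x ∈ pyramidPrism D k n m ∧ ∀ i, ∃ z : ℤ, x i = (z : ℝ)} =
      (m * (∑ a ∈ Finset.range (2 * k + 1), ∑ b ∈ Finset.range (2 * k + 1), squareDepth k a b) +
        (2 * k + 1) ^ 2) * (n + 1) ^ D := by
  have hm' : (0 : ℝ) < m := by exact_mod_cast hm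
  let A : Finset (Σ _ : ℕ × ℕ, ℕ) :=
    (Finset.range (2 * k + 1) ×ˢ Finset.range (2 * k + 1)).sigma
      fun p => Finset.range (m * squareDepth k p.1 p.2 + 1)
  let B : Finset (Fin D → ℕ) := Fintype.piFinset fun _ => Finset.range (n + 1)
  let g : (Σ _ : ℕ × ℕ, ℕ) × (Fin D → ℕ) → Fin (D + 3) → ℝ := fun q =>
    Fin.cons (q.1.1.1 : ℝ) (Fin.cons (q.1.1.2 : ℝ) (Fin.cons (q.1.2 : ℝ) fun i => (q.2 i : ℝ)))
  have hg : Function.Injective g := by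
    rintro ⟨⟨⟨a, b⟩, c⟩, w⟩ ⟨⟨⟨a', b'⟩, c'⟩, w'⟩ h
    rw [funext_iff, forall_fin_add_three] at h
    obtain ⟨h0, h1, h2, h3⟩ := h
    obtain rfl : a = a' := Nat.cast_injective (R := ℝ) h0
    obtain rfl : b = b' := Nat.cast_injective (R := ℝ) h1
    obtain rfl : c = c' := Nat.cast_injective (R := ℝ) h2
    obtain rfl : w = w' := funext fun i => Nat.cast_injective (R := ℝ) (h3 i)
    rfl
  have hmem (a b c : ℕ) (w : Fin D → ℕ) : (⟨⟨a, b⟩, c⟩, w) ∈ A ×ˢ B ↔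
      g (⟨⟨a, b⟩, c⟩, w) ∈ pyramidPrism D k n m := by
    have e : g (⟨⟨a, b⟩, c⟩, w) ∈ pyramidPrism D k n m ↔ (0 : ℝ) ≤ c ∧ (c : ℝ) ≤ m * a ∧
      (c : ℝ) ≤ m * b ∧ (c : ℝ) ≤ m * (2 * k - a) ∧ (c : ℝ) ≤ m * (2 * k - b) ∧
      ∀ i : Fin D, (0 : ℝ) ≤ w i ∧ (w i : ℝ) ≤ n := Iff.rfl
    have cast (a : ℕ) : (c : ℝ) ≤ m * (2 * k - a) ↔ a ≤ 2 * k ∧ c ≤ m * (2 * k - a) := by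
      constructor
      · intro h
        have h' : a ≤ 2 * k := by
          have : (0 : ℝ) ≤ m * (2 * k - a) := (Nat.cast_nonneg c).trans h
          have := nonneg_of_mul_nonneg_right this hm'
          exact_mod_cast sub_nonneg.1 this
        refine ⟨h', ?_⟩
        rw [← Nat.cast_le (α := ℝ)]; push_cast [h']; exact h
      · rintro ⟨h', h⟩
        rw [← Nat.cast_le (α := ℝ)] at h; push_cast [h'] at h; exact h
    rw [e, cast, cast]
    simp only [A, B, Finset.mem_product, Finset.mem_sigma, Finset.mem_range, Order.lt_add_one_iff,
      Fintype.mem_piFinset, le_mul_squareDepth, Nat.cast_nonneg, true_and, Nat.cast_le]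
    norm_cast
    tauto
  have himage : {x : Fin (D + 3) → ℝ | x ∈ pyramidPrism D k n m ∧ ∀ i, ∃ z : ℤ, x i = (z : ℝ)} =
      g '' (A ×ˢ B : Finset _) := by
    ext x
    constructor
    · rintro ⟨hx, hz⟩
      obtain ⟨h0, h1, h2, h3, h4, h5⟩ := id hx
      obtain ⟨a, ha⟩ := exists_nat_of_nonneg_of_int
        (nonneg_of_mul_nonneg_right (h0.trans h1) hm') (hz 0)
      obtain ⟨b, hb⟩ := exists_nat_of_nonneg_of_int
        (nonneg_of_mul_nonneg_right (h0.trans h2) hm') (hz 1)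
      obtain ⟨c, hc⟩ := exists_nat_of_nonneg_of_int h0 (hz 2)
      choose w hw using fun i => exists_nat_of_nonneg_of_int (h5 i).1 (hz _)
      obtain rfl : g (⟨⟨a, b⟩, c⟩, w) = x := by
        rw [funext_iff, forall_fin_add_three]
        exact ⟨ha.symm, hb.symm, hc.symm, fun i => (hw i).symm⟩
      exact ⟨_, (hmem a b c w).2 hx, rfl⟩
    · rintro ⟨⟨⟨⟨a, b⟩, c⟩, w⟩, hq, rfl⟩
      refine ⟨(hmem a b c w).1 hq, ?_⟩
      rw [forall_fin_add_three]
      exact ⟨⟨a, by simp [g]⟩, ⟨b, rfl⟩, ⟨c, rfl⟩, fun i => ⟨w i, rfl⟩⟩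
  rw [himage, Set.ncard_image_of_injective _ hg, Set.ncard_coe_finset, Finset.card_product,
    Finset.card_sigma, Fintype.card_piFinset, Finset.sum_product]
  simp only [Finset.card_range, Finset.prod_const, Finset.card_univ, Fintype.card_fin,
    Finset.sum_add_distrib, ← Finset.mul_sum, Finset.sum_const, smul_eq_mul]
  ring

theorem latticeCount_pyramidPrism (D : ℕ) {k n M t : ℕ} (hM : 0 < M) (ht : 0 < t) :
    (latticeCount (pyramidPrism D k n ((3 * M : ℕ) : ℝ)) t : ℚ) =
      (M * (4 * k ^ 3 * t ^ 3 - k * t) + (2 * k * t + 1) ^ 2) * (n * t + 1) ^ D := by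
  have h := ncard_pyramidPrism D (k := t * k) (n := t * n) (m := 3 * M) (by positivity)
  have hs := sum_squareDepth (t * k)
  rw [latticeCount, smul_pyramidPrism D _ _ _ (by exact_mod_cast ht)]
  rw [Nat.cast_mul t, Nat.cast_mul t] at h
  rw [h]
  qify at hs
  push_cast
  linear_combination (M : ℚ) * (t * n + 1) ^ D * hs

open Polynomial in
/-- The Ehrhart polynomial of `pyramidPrism D k n (3 * M)`. -/
noncomputable def pyramidPrismEhrhart (D k n M : ℕ) : ℚ[X] :=
  (C (M : ℚ) * (C (4 * (k : ℚ) ^ 3) * X ^ 3 - C (k : ℚ) * X) + (C (2 * (k : ℚ)) * X + 1) ^ 2) *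
    (C (n : ℚ) * X + 1) ^ D

theorem eval_pyramidPrismEhrhart (D k n M : ℕ) (t : ℚ) : (pyramidPrismEhrhart D k n M).eval t =
      (M * (4 * k ^ 3 * t ^ 3 - k * t) + (2 * k * t + 1) ^ 2) * (n * t + 1) ^ D := by
  simp [pyramidPrismEhrhart]

theorem coeff_C_mul_X_add_one_pow (D : ℕ) (n : ℚ) (j : ℕ) :
    ((Polynomial.C n * Polynomial.X + 1) ^ D).coeff j = n ^ j * D.choose j := by
  have : (Polynomial.C n * Polynomial.X + 1) ^ D =
      ((1 + Polynomial.X : Polynomial ℚ) ^ D).comp (Polynomial.C n * Polynomial.X) := by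
    simp [add_comm]
  rw [this, Polynomial.comp_C_mul_X_coeff, Polynomial.coeff_one_add_X_pow, mul_comm]

open Polynomial in
theorem pyramidPrismEhrhart_eq (D k n M : ℕ) : pyramidPrismEhrhart D k n M =
    C (4 * M * k ^ 3 : ℚ) * ((C (n : ℚ) * X + 1) ^ D * X ^ 3) +
    C (4 * k ^ 2 : ℚ) * ((C (n : ℚ) * X + 1) ^ D * X ^ 2) +
    C ((4 - M) * k : ℚ) * ((C (n : ℚ) * X + 1) ^ D * X) +
    (C (n : ℚ) * X + 1) ^ D := by
  simp only [pyramidPrismEhrhart, map_mul, map_sub, map_pow, map_ofNat]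
  ring

theorem coeff_zero_pyramidPrismEhrhart (D k n M : ℕ) :
    (pyramidPrismEhrhart D k n M).coeff 0 = 1 := by
  simp [Polynomial.coeff_zero_eq_eval_zero, eval_pyramidPrismEhrhart]

theorem coeff_one_pyramidPrismEhrhart (D k n M : ℕ) :
    (pyramidPrismEhrhart D k n M).coeff 1 = (4 - M) * k + n * D := by
  rw [pyramidPrismEhrhart_eq]
  simp only [Polynomial.coeff_add, Polynomial.coeff_C_mul, Polynomial.coeff_mul_X_pow',
    Polynomial.coeff_mul_X (n := 0), coeff_C_mul_X_add_one_pow]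
  norm_num

theorem coeff_two_pyramidPrismEhrhart (D k n M : ℕ) :
    (pyramidPrismEhrhart D k n M).coeff 2 =
      4 * k ^ 2 + (4 - M) * k * (n * D) + n ^ 2 * D.choose 2 := by
  rw [pyramidPrismEhrhart_eq]
  simp only [Polynomial.coeff_add, Polynomial.coeff_C_mul, Polynomial.coeff_mul_X_pow',
    Polynomial.coeff_mul_X (n := 1), coeff_C_mul_X_add_one_pow]
  norm_num

theorem coeff_add_three_pyramidPrismEhrhart (D k n M i : ℕ) :
    (pyramidPrismEhrhart D k n M).coeff (i + 3) =
      4 * M * k ^ 3 * (n ^ i * D.choose i) + 4 * k ^ 2 * (n ^ (i + 1) * D.choose (i + 1)) +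
      (4 - M) * k * (n ^ (i + 2) * D.choose (i + 2)) + n ^ (i + 3) * D.choose (i + 3) := by
  rw [pyramidPrismEhrhart_eq]
  simp only [Polynomial.coeff_add, Polynomial.coeff_C_mul, Polynomial.coeff_mul_X_pow,
    Polynomial.coeff_mul_X_pow (d := i + 1) (n := 2), Polynomial.coeff_mul_X (n := i + 2),
    coeff_C_mul_X_add_one_pow]

theorem natDegree_pyramidPrismEhrhart {D k n M : ℕ} (hk : 0 < k) (hn : 0 < n) (hM : 0 < M) :
    (pyramidPrismEhrhart D k n M).natDegree = D + 3 := by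
  refine Polynomial.natDegree_eq_of_le_of_coeff_ne_zero ?_ ?_
  · rw [Polynomial.natDegree_le_iff_coeff_eq_zero]
    intro N hN
    obtain ⟨i, rfl⟩ : ∃ i, N = i + 3 := ⟨N - 3, by omega⟩
    rw [coeff_add_three_pyramidPrismEhrhart, Nat.choose_eq_zero_of_lt (show D < i by omega),
      Nat.choose_eq_zero_of_lt (show D < i + 1 by omega),
      Nat.choose_eq_zero_of_lt (show D < i + 2 by omega),
      Nat.choose_eq_zero_of_lt (show D < i + 3 by omega)]
    simp
  · rw [coeff_add_three_pyramidPrismEhrhart]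
    rw [Nat.choose_eq_zero_of_lt (show D < D + 1 by omega),
      Nat.choose_eq_zero_of_lt (show D < D + 2 by omega),
      Nat.choose_eq_zero_of_lt (show D < D + 3 by omega)]
    simp [hk.ne', hn.ne', hM.ne']

theorem choose_add_two_mul (D i : ℕ) :
    D.choose (i + 2) * ((i + 2) * (i + 1)) = D.choose i * ((D - i) * (D - (i + 1))) := by
  have h1 := Nat.choose_succ_right_eq D i
  have h2 := Nat.choose_succ_right_eq D (i + 1)
  rw [← mul_assoc, h2, mul_right_comm, h1, mul_assoc]

/-- For suitable parameters, the coefficients of `t ^ j` are negative exactly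
for `1 ≤ j ≤ s` in the range `1 ≤ j ≤ D + 1`. -/
theorem exists_pyramidPrismEhrhart_sign (D s : ℕ) (hs : s ≤ D) :
    ∃ k n M : ℕ, 0 < k ∧ 0 < n ∧ 0 < M ∧
      (∀ j, 1 ≤ j → j ≤ s → (pyramidPrismEhrhart D k n M).coeff j < 0) ∧
      (∀ j, s + 1 ≤ j → j ≤ D + 1 → 0 < (pyramidPrismEhrhart D k n M).coeff j) := by
  rcases s with _ | _ | q
  · refine ⟨1, 1, 1, one_pos, one_pos, one_pos, fun j h h' => by omega, fun j h h' => ?_⟩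
    rcases j with _ | _ | _ | i
    · omega
    · rw [coeff_one_pyramidPrismEhrhart]; norm_num; positivity
    · rw [coeff_two_pyramidPrismEhrhart]; norm_num; positivity
    · have : 0 < D.choose (i + 2) := Nat.choose_pos (by omega)
      rw [coeff_add_three_pyramidPrismEhrhart]; norm_num; positivity
  · refine ⟨D + 1, 1, 5, by omega, one_pos, by omega, fun j h h' => ?_, fun j h h' => ?_⟩
    · obtain rfl : j = 1 := by omega
      rw [coeff_one_pyramidPrismEhrhart]; push_cast; linarith
    · rcases j with _ | _ | _ | i
      · omega
      · omega
      · rw [coeff_two_pyramidPrismEhrhart]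
        have : (0 : ℚ) ≤ D.choose 2 := by positivity
        push_cast
        nlinarith [show (0 : ℚ) ≤ D by positivity]
      · rw [coeff_add_three_pyramidPrismEhrhart]
        have h1 : 0 < D.choose (i + 1) := Nat.choose_pos (by omega)
        have h2 : D.choose (i + 2) ≤ D.choose (i + 1) * D := by
          have := Nat.choose_succ_right_eq D (i + 1)
          calc D.choose (i + 2) ≤ D.choose (i + 2) * (i + 1 + 1) :=
                Nat.le_mul_of_pos_right _ (by omega)
            _ = D.choose (i + 1) * (D - (i + 1)) := this
            _ ≤ _ := Nat.mul_le_mul_left _ (by omega)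
        have h3 : (D.choose (i + 2) : ℚ) ≤ D.choose (i + 1) * D := by exact_mod_cast h2
        have h1' : (0 : ℚ) < D.choose (i + 1) := by exact_mod_cast h1
        have h4 : (0 : ℚ) ≤ D.choose i := by positivity
        have h5 : (0 : ℚ) ≤ D.choose (i + 3) := by positivity
        have hD : (0 : ℚ) ≤ D := by positivity
        have h6 : ((D : ℚ) + 1) * D.choose (i + 2) < 4 * (D + 1) ^ 2 * D.choose (i + 1) := by
          nlinarith [mul_le_mul_of_nonneg_left h3 (show (0 : ℚ) ≤ D + 1 by positivity),
            mul_nonneg hD h1'.le]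
        have h7 : (0 : ℚ) ≤ 4 * 5 * (D + 1) ^ 3 * D.choose i := by positivity
        push_cast
        simp only [one_pow, one_mul]
        linarith
  · set k := D - q with hk
    have hkq : D = k + q := by omega
    set n := 2 * (q + 1) with hn
    have hn0 : 0 < n := by omega
    have hk0 : 0 < k := by omega
    let ε : ℕ → ℕ := fun i => 4 * k ^ 2 * (n ^ (i + 1) * D.choose (i + 1)) +
      4 * k * (n ^ (i + 2) * D.choose (i + 2)) + n ^ (i + 3) * D.choose (i + 3)
    let M : ℕ := 1 + (4 * k + n * D) + (4 * k ^ 2 + 4 * k * (n * D) + n ^ 2 * D.choose 2) +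
      ∑ i ∈ Finset.range (D + 1), ε i
    have hM0 : 0 < M := by positivity
    refine ⟨k, n, M, hk0, hn0, hM0, fun j h h' => ?_, fun j h h' => ?_⟩
    · rcases j with _ | _ | _ | i
      · omega
      · rw [coeff_one_pyramidPrismEhrhart]
        have h1 : 4 * k + n * D < M := by dsimp only [M]; omega
        have h2 : M ≤ M * k := Nat.le_mul_of_pos_right _ hk0
        have h3 : ((4 * k + n * D : ℕ) : ℚ) < (M * k : ℕ) := by exact_mod_cast h1.trans_le h2
        push_cast at h3
        linarith
      · rw [coeff_two_pyramidPrismEhrhart]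
        have h1 : 4 * k ^ 2 + 4 * k * (n * D) + n ^ 2 * D.choose 2 < M := by dsimp only [M]; omega
        have h2 : M ≤ M * (k * (n * D)) :=
          Nat.le_mul_of_pos_right _ (Nat.mul_pos hk0 (Nat.mul_pos hn0 (by omega)))
        have h3 : ((4 * k ^ 2 + 4 * k * (n * D) + n ^ 2 * D.choose 2 : ℕ) : ℚ) <
          (M * (k * (n * D)) : ℕ) := by exact_mod_cast h1.trans_le h2
        push_cast at h3
        linarith
      · rw [coeff_add_three_pyramidPrismEhrhart]
        have h1 : ε i < M := by
          have := Finset.single_le_sum (f := ε) (fun _ _ => Nat.zero_le _)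
            (Finset.mem_range.2 (show i < D + 1 by omega))
          dsimp only [M]; omega
        have hc := choose_add_two_mul D i
        have hpos : 0 < D.choose (i + 2) := Nat.choose_pos (by omega)
        have h2 : D.choose i * k ^ 2 < D.choose (i + 2) * (q + 1) ^ 2 := by
          calc D.choose i * k ^ 2 ≤ D.choose i * ((D - i) * (D - (i + 1))) := by
                rw [sq]
                exact Nat.mul_le_mul_left _ (Nat.mul_le_mul (by omega) (by omega))
            _ = _ := hc.symm
            _ < _ := by
                refine Nat.mul_lt_mul_of_pos_left ?_ hpos
                rw [sq]
                exact Nat.mul_lt_mul_of_le_of_lt (by omega) (by omega) (by omega)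
        have h3 : 4 * k ^ 3 * (n ^ i * D.choose i) < k * (n ^ (i + 2) * D.choose (i + 2)) := by
          have e1 : 4 * k ^ 3 * (n ^ i * D.choose i) = 4 * k * n ^ i * (D.choose i * k ^ 2) := by
            ring
          have e2 : k * (n ^ (i + 2) * D.choose (i + 2)) =
              4 * k * n ^ i * (D.choose (i + 2) * (q + 1) ^ 2) := by
            rw [pow_add, hn]; ring
          rw [e1, e2]
          exact Nat.mul_lt_mul_of_pos_left h2 (by positivity)
        have h4 : M * (4 * k ^ 3 * (n ^ i * D.choose i)) + ε i <
            M * (k * (n ^ (i + 2) * D.choose (i + 2))) := by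
          have := Nat.mul_le_mul_left M (Nat.succ_le_of_lt h3)
          rw [Nat.succ_eq_add_one, mul_add] at this
          omega
        have h5 := (Nat.cast_lt (α := ℚ)).2 h4
        simp only [ε] at h5
        push_cast at h5
        linarith
    · rcases j with _ | _ | _ | i
      · omega
      · omega
      · omega
      · rw [coeff_add_three_pyramidPrismEhrhart]
        have hc := choose_add_two_mul D i
        have hpos : 0 < D.choose (i + 2) := Nat.choose_pos (by omega)
        have h2 : D.choose (i + 2) * (q + 1) ^ 2 < D.choose i * k ^ 2 := by
          calc D.choose (i + 2) * (q + 1) ^ 2 < D.choose (i + 2) * ((i + 2) * (i + 1)) := by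
                refine Nat.mul_lt_mul_of_pos_left ?_ hpos
                rw [sq]
                exact Nat.mul_lt_mul_of_lt_of_le (by omega) (by omega) (by omega)
            _ = _ := hc
            _ ≤ D.choose i * k ^ 2 := by
                rw [sq]
                exact Nat.mul_le_mul_left _ (Nat.mul_le_mul (by omega) (by omega))
        have h3 : k * (n ^ (i + 2) * D.choose (i + 2)) < 4 * k ^ 3 * (n ^ i * D.choose i) := by
          have e1 : 4 * k ^ 3 * (n ^ i * D.choose i) = 4 * k * n ^ i * (D.choose i * k ^ 2) := by
            ring
          have e2 : k * (n ^ (i + 2) * D.choose (i + 2)) =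
              4 * k * n ^ i * (D.choose (i + 2) * (q + 1) ^ 2) := by
            rw [pow_add, hn]; ring
          rw [e1, e2]
          exact Nat.mul_lt_mul_of_pos_left h2 (by positivity)
        have h4 := (Nat.cast_lt (α := ℚ)).2 (Nat.mul_lt_mul_of_pos_left h3 hM0)
        have h5 : (0 : ℚ) ≤ ε i := Nat.cast_nonneg _
        simp only [ε] at h5
        push_cast at h4 h5
        linarith

theorem beta_positive_rest_negative (β d : ℕ) (hβ : 0 < β) (hd : 0 < d)
    (hdβ : β + 2 ≤ d) :
    ∃ (P : Set (Fin d → ℝ)) (p : Polynomial ℚ),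
      IsIntegralPolytope P ∧ affineSpan ℝ P = ⊤ ∧
      p.natDegree = d ∧ p.coeff 0 = 1 ∧
      (∀ t : ℕ, 0 < t → (latticeCount P t : ℚ) = p.eval (t : ℚ)) ∧
      (∀ j : ℕ, d - β - 1 ≤ j → j ≤ d - 2 → 0 < p.coeff j) ∧
      (∀ j : ℕ, 1 ≤ j → j ≤ d - β - 2 → p.coeff j < 0) := by
  obtain ⟨D, rfl⟩ : ∃ D, d = D + 3 := ⟨d - 3, by omega⟩
  obtain ⟨k, n, M, hk, hn, hM, hneg, hpos⟩ :=
    exists_pyramidPrismEhrhart_sign D (D + 3 - β - 2) (by omega)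
  refine ⟨pyramidPrism D k n ((3 * M : ℕ) : ℝ), pyramidPrismEhrhart D k n M,
    isIntegralPolytope_pyramidPrism D hk (by positivity),
    affineSpan_pyramidPrism D (by positivity) (by positivity) (by positivity),
    natDegree_pyramidPrismEhrhart hk hn hM, coeff_zero_pyramidPrismEhrhart D k n M,
    fun t ht => ?_, fun j h h' => hpos j (by omega) (by omega), hneg⟩
  rw [eval_pyramidPrismEhrhart, latticeCount_pyramidPrism D hM ht]
end

section
/- For every subset S of {1, 2, 3, 4, 5} there exist a full-dimensional integral polytope P ⊆ ℝ^7 and a polynomial p of degree 7 with rational coefficients and constant coefficient 1 such that i(P,t) = p(t) for every positive integer t, the coefficient of t^i in p is negative for every i ∈ S, and the coefficient of t^i in p is positive for every i ∈ {1, 2, …, 7} \ S. -/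
open scoped Pointwise BigOperators

/-- The vertices `0`, `e₁, …, eₙ` and `(-w₁, …, -wₙ, m)` of a lattice simplex of normalized
volume `m`. -/
def simplexVertices {n : ℕ} (m : ℕ) (w : Fin n → ℕ) : Set (Fin (n + 1) → ℝ) :=
  insert 0 (insert (Fin.snoc (fun i => -(w i : ℝ)) (m : ℝ))
    (Set.range fun i : Fin n => Fin.snoc (Pi.single i (1 : ℝ)) (0 : ℝ)))

/-- The lattice simplex with vertex set `simplexVertices m w`. -/
def latticeSimplex {n : ℕ} (m : ℕ) (w : Fin n → ℕ) : Set (Fin (n + 1) → ℝ) :=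
  convexHull ℝ (simplexVertices m w)

/-- The height of the `r`-th lattice point of the half-open parallelepiped spanned by
`simplexVertices m w`. -/
def boxHeight {n : ℕ} (m : ℕ) (w : Fin n → ℕ) (r : ℕ) : ℕ :=
  (∑ i, w i * r % m + r + (m - 1)) / m

theorem isIntegralPolytope_latticeSimplex {n : ℕ} (m : ℕ) (w : Fin n → ℕ) :
    IsIntegralPolytope (latticeSimplex m w) := by
  have hfin : (simplexVertices m w).Finite := ((Set.finite_range _).insert _).insert _
  refine ⟨hfin.toFinset, fun v hv => ?_, by rw [Set.Finite.coe_toFinset]; rfl⟩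
  rw [Set.Finite.mem_toFinset] at hv
  rcases hv with rfl | rfl | ⟨j, rfl⟩
  · exact fun i => ⟨0, by simp⟩
  · refine Fin.lastCases ⟨m, by simp⟩ fun i => ⟨-w i, by simp⟩
  · refine Fin.lastCases ⟨0, by simp⟩ fun i => ⟨if i = j then 1 else 0, ?_⟩
    simp [Pi.single_apply]

/-- The coordinates of a point with respect to the nonzero vertices of a lattice simplex. -/
theorem eq_sum_simplexVertices {n m : ℕ} (hm : 0 < m) (w : Fin n → ℕ) (x : Fin (n + 1) → ℝ) :
    x = ∑ i, ((m * x i.castSucc + w i * x (Fin.last n)) / m) •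
        (Fin.snoc (Pi.single i (1 : ℝ)) (0 : ℝ) : Fin (n + 1) → ℝ) +
      (x (Fin.last n) / m) • (Fin.snoc (fun i => -(w i : ℝ)) (m : ℝ) : Fin (n + 1) → ℝ) := by
  have hm' : (m : ℝ) ≠ 0 := by positivity
  funext k
  refine Fin.lastCases ?_ (fun j => ?_) k
  · simp [hm']
  · simp [Finset.sum_apply, Pi.single_apply]
    field_simp
    ring

theorem affineSpan_latticeSimplex {n m : ℕ} (hm : 0 < m) (w : Fin n → ℕ) :
    affineSpan ℝ (latticeSimplex m w) = ⊤ := by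
  rw [latticeSimplex, affineSpan_convexHull]
  have h0 : (0 : Fin (n + 1) → ℝ) ∈ simplexVertices m w := Set.mem_insert _ _
  rw [AffineSubspace.affineSpan_eq_top_iff_vectorSpan_eq_top_of_nonempty ℝ _ _ ⟨0, h0⟩, eq_top_iff]
  have hv : ∀ v ∈ simplexVertices m w, v ∈ vectorSpan ℝ (simplexVertices m w) := fun v hv => by
    simpa using vsub_mem_vectorSpan ℝ hv h0
  intro x _
  rw [eq_sum_simplexVertices hm w x]
  exact add_mem (sum_mem fun i _ => Submodule.smul_mem _ _ (hv _ (.inr (.inr ⟨i, rfl⟩))))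
    (Submodule.smul_mem _ _ (hv _ (.inr (.inl rfl))))

theorem mem_latticeSimplex {n m : ℕ} (hm : 0 < m) (w : Fin n → ℕ) (x : Fin (n + 1) → ℝ) :
    x ∈ latticeSimplex m w ↔
      (∀ i : Fin n, 0 ≤ m * x i.castSucc + w i * x (Fin.last n)) ∧ 0 ≤ x (Fin.last n) ∧
        ∑ i : Fin n, (m * x i.castSucc + w i * x (Fin.last n)) + x (Fin.last n) ≤ m := by
  have hm' : (0 : ℝ) < m := by positivity
  constructor
  · let K : Set (Fin (n + 1) → ℝ) := {x |
      (∀ i : Fin n, 0 ≤ m * x i.castSucc + w i * x (Fin.last n)) ∧ 0 ≤ x (Fin.last n) ∧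
        ∑ i : Fin n, (m * x i.castSucc + w i * x (Fin.last n)) + x (Fin.last n) ≤ m}
    have hK : Convex ℝ K := by
      rintro x ⟨hx1, hx2, hx3⟩ y ⟨hy1, hy2, hy3⟩ a b ha hb hab
      have key : ∀ i : Fin n, m * (a • x + b • y) i.castSucc + w i * (a • x + b • y) (Fin.last n) =
          a * (m * x i.castSucc + w i * x (Fin.last n)) +
            b * (m * y i.castSucc + w i * y (Fin.last n)) := fun i => by
        simp; ring
      refine ⟨fun i => ?_, ?_, ?_⟩
      · rw [key]
        have := hx1 i
        have := hy1 i
        positivity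
      · simp only [Pi.add_apply, Pi.smul_apply, smul_eq_mul]
        positivity
      · simp only [key]
        rw [Finset.sum_add_distrib, ← Finset.mul_sum, ← Finset.mul_sum]
        simp only [Pi.add_apply, Pi.smul_apply, smul_eq_mul]
        calc _ = a * (∑ i : Fin n, (m * x i.castSucc + w i * x (Fin.last n)) + x (Fin.last n)) +
              b * (∑ i : Fin n, (m * y i.castSucc + w i * y (Fin.last n)) + y (Fin.last n)) := by
                ring
          _ ≤ a * m + b * m := by gcongr
          _ = m := by rw [← add_mul, hab, one_mul]
    suffices latticeSimplex m w ⊆ K from fun hx => this hx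
    refine convexHull_min ?_ hK
    rintro v (rfl | rfl | ⟨j, rfl⟩)
    · simp [K]
    · simp [K, mul_comm]
    · simp [K, Pi.single_apply]
      intro i
      split_ifs <;> simp
  · rintro ⟨h1, h2, h3⟩
    have hV : simplexVertices m w ⊆ latticeSimplex m w := subset_convexHull ℝ _
    have hc : Convex ℝ (latticeSimplex m w) := convex_convexHull ℝ _
    let c : Fin n → ℝ := fun i => (m * x i.castSucc + w i * x (Fin.last n)) / m
    let s : ℝ := 1 - (∑ i, c i + x (Fin.last n) / m)
    have hs : 0 ≤ s := by
      simp only [s, c, ← Finset.sum_div, ← add_div, sub_nonneg]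
      rwa [div_le_one hm']
    have := hc.sum_mem (t := Finset.univ)
      (w := fun o : Option (Option (Fin n)) => o.elim s fun o => o.elim (x (Fin.last n) / m) c)
      (z := fun o => o.elim 0 fun o => o.elim (Fin.snoc (fun i => -(w i : ℝ)) (m : ℝ))
        fun i => Fin.snoc (Pi.single i (1 : ℝ)) (0 : ℝ)) ?_ ?_ ?_
    · rw [eq_sum_simplexVertices hm w x]
      simpa [Fintype.sum_option, add_comm, c] using this
    · rintro (_ | _ | i) -
      · exact hs
      · exact div_nonneg h2 hm'.le
      · exact div_nonneg (h1 i) hm'.le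
    · simp [Fintype.sum_option, s]
      ring
    · rintro (_ | _ | i) -
      · exact hV (.inl rfl)
      · exact hV (.inr (.inl rfl))
      · exact hV (.inr (.inr ⟨i, rfl⟩))

theorem mem_smul_latticeSimplex {n m t : ℕ} (hm : 0 < m) (ht : 0 < t) (w : Fin n → ℕ)
    (x : Fin (n + 1) → ℝ) :
    x ∈ (t : ℝ) • latticeSimplex m w ↔
      (∀ i : Fin n, 0 ≤ m * x i.castSucc + w i * x (Fin.last n)) ∧ 0 ≤ x (Fin.last n) ∧
        ∑ i : Fin n, (m * x i.castSucc + w i * x (Fin.last n)) + x (Fin.last n) ≤ t * m := by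
  have ht' : (0 : ℝ) < t := by positivity
  have key : ∀ i : Fin n, m * ((t : ℝ)⁻¹ • x) i.castSucc + w i * ((t : ℝ)⁻¹ • x) (Fin.last n) =
      (t : ℝ)⁻¹ * (m * x i.castSucc + w i * x (Fin.last n)) := fun i => by
    simp; ring
  rw [Set.mem_smul_set_iff_inv_smul_mem₀ ht'.ne', mem_latticeSimplex hm]
  simp only [key, ← Finset.mul_sum]
  simp only [Pi.smul_apply, smul_eq_mul, ← mul_add, inv_mul_le_iff₀ ht',
    mul_nonneg_iff_of_pos_left (inv_pos.2 ht')]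

/-- The lattice point in a dilate of `latticeSimplex m w` with box point `r`, whose coefficients at
the nonzero vertices have integer parts `z`. The last entry of `z` belongs to the vertex `0` and
does not matter. -/
def boxPoint {n : ℕ} (m : ℕ) (w : Fin n → ℕ) (r : ℕ) (z : Fin (n + 2) → ℕ) : Fin (n + 1) → ℝ :=
  Fin.snoc
    (fun i => (z i.castSucc.castSucc : ℝ) - w i * z (Fin.last n).castSucc - (w i * r / m : ℕ))
    ((z (Fin.last n).castSucc : ℝ) * m + r)

theorem boxPoint_facet {n : ℕ} (m : ℕ) (w : Fin n → ℕ) (r : ℕ) (z : Fin (n + 2) → ℕ) (i : Fin n) :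
    m * boxPoint m w r z i.castSucc + w i * boxPoint m w r z (Fin.last n) =
      (m * z i.castSucc.castSucc + w i * r % m : ℕ) := by
  have h : (m : ℝ) * (w i * r / m : ℕ) + (w i * r % m : ℕ) = w i * r := by
    exact_mod_cast Nat.div_add_mod (w i * r) m
  simp only [boxPoint, Fin.snoc_castSucc, Fin.snoc_last, Nat.cast_add, Nat.cast_mul]
  linear_combination -h

theorem boxHeight_le_iff {n m : ℕ} (hm : 0 < m) (w : Fin n → ℕ) (r k : ℕ) :
    boxHeight m w r ≤ k ↔ ∑ i, w i * r % m + r ≤ k * m := by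
  rw [boxHeight, ← Nat.lt_succ_iff, Nat.div_lt_iff_lt_mul hm, Nat.succ_mul]
  omega

theorem boxPoint_mem_smul {n m t : ℕ} (hm : 0 < m) (ht : 0 < t) (w : Fin n → ℕ) (r : ℕ)
    (z : Fin (n + 2) → ℕ) :
    boxPoint m w r z ∈ (t : ℝ) • latticeSimplex m w ↔
      ∑ i : Fin (n + 1), z i.castSucc + boxHeight m w r ≤ t := by
  rw [mem_smul_latticeSimplex hm ht]
  simp only [boxPoint_facet]
  have h : ∑ i : Fin (n + 1), z i.castSucc + boxHeight m w r ≤ t ↔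
      ∑ i : Fin n, (m * z i.castSucc.castSucc + w i * r % m) +
        (z (Fin.last n).castSucc * m + r) ≤ t * m := by
    rw [Fin.sum_univ_castSucc, Finset.sum_add_distrib, ← Finset.mul_sum]
    generalize ∑ i : Fin n, z i.castSucc.castSucc = a
    generalize z (Fin.last n).castSucc = q
    constructor
    · intro h
      have := (boxHeight_le_iff hm w r (t - (a + q))).1 (by omega)
      have h2 : (t - (a + q)) * m + (a + q) * m = t * m := by rw [← add_mul]; congr 1; omega
      nlinarith
    · intro h
      have h1 : a + q ≤ t := by
        by_contra! hlt
        nlinarith [Nat.zero_le (∑ i, w i * r % m), Nat.mul_le_mul_right m hlt.le,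
          Nat.mul_lt_mul_of_pos_right hlt hm]
      have := (boxHeight_le_iff hm w r (t - (a + q))).2 (by
        have h2 : (t - (a + q)) * m + (a + q) * m = t * m := by rw [← add_mul]; congr 1; omega
        nlinarith)
      omega
  rw [h]
  constructor
  · rintro ⟨-, -, h3⟩
    simp only [boxPoint, Fin.snoc_last] at h3
    exact_mod_cast h3
  · refine fun h3 => ⟨fun i => by positivity, ?_, ?_⟩
    · simp only [boxPoint, Fin.snoc_last]
      positivity
    · simp only [boxPoint, Fin.snoc_last]
      exact_mod_cast h3

theorem exists_boxPoint_eq {n m t : ℕ} (hm : 0 < m) (ht : 0 < t) (w : Fin n → ℕ)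
    (x : Fin (n + 1) → ℝ) (hx : x ∈ (t : ℝ) • latticeSimplex m w) (hz : ∀ i, ∃ z : ℤ, x i = z) :
    ∃ r < m, ∃ y : Fin (n + 1) → ℕ, ∀ s, boxPoint m w r (Fin.snoc y s) = x := by
  obtain ⟨h1, h2, -⟩ := (mem_smul_latticeSimplex hm ht w x).1 hx
  choose c hc using hz
  simp only [hc] at h1 h2
  obtain ⟨k, hk⟩ := Int.eq_ofNat_of_zero_le (a := c (Fin.last n)) (by exact_mod_cast h2)
  have hy : ∀ i : Fin n, ∃ y : ℕ, c i.castSucc + w i * (k / m : ℕ) + (w i * (k % m) / m : ℕ) = y := by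
    refine fun i => Int.eq_ofNat_of_zero_le ?_
    have h3 : 0 ≤ m * c i.castSucc + w i * (k : ℤ) := by
      have := h1 i
      rw [hk] at this
      exact_mod_cast this
    have h4 : (m : ℤ) * (k / m : ℕ) + (k % m : ℕ) = k := by exact_mod_cast Nat.div_add_mod k m
    have h5 : (m : ℤ) * (w i * (k % m) / m : ℕ) + (w i * (k % m) % m : ℕ) = w i * (k % m : ℕ) := by
      exact_mod_cast Nat.div_add_mod (w i * (k % m)) m
    have h6 : ((w i * (k % m) % m : ℕ) : ℤ) < m := by exact_mod_cast Nat.mod_lt _ hm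
    by_contra! h7
    have h8 : c i.castSucc + w i * (k / m : ℕ) + (w i * (k % m) / m : ℕ) ≤ -1 := by omega
    have h9 := mul_le_mul_of_nonneg_left h8 (Int.natCast_nonneg m)
    rw [← h4] at h3
    linarith
  choose y hy using hy
  refine ⟨k % m, Nat.mod_lt _ hm, Fin.snoc y (k / m), fun s => ?_⟩
  funext j
  refine Fin.lastCases ?_ (fun i => ?_) j
  · simp only [boxPoint, Fin.snoc_last, Fin.snoc_castSucc, hc, hk, Int.cast_natCast]
    exact_mod_cast Nat.div_add_mod' k m
  · simp only [boxPoint, Fin.snoc_last, Fin.snoc_castSucc, hc]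
    have := congrArg (Int.cast : ℤ → ℝ) (hy i)
    simp only [Int.cast_add, Int.cast_mul, Int.cast_natCast] at this
    linarith

theorem latticeCount_latticeSimplex {n m t : ℕ} (hm : 0 < m) (ht : 0 < t) (w : Fin n → ℕ) :
    latticeCount (latticeSimplex m w) t = ∑ r ∈ Finset.range m,
      if boxHeight m w r ≤ t then (t - boxHeight m w r + (n + 1)).choose (n + 1) else 0 := by
  classical
  let U : Finset (Σ _ : ℕ, Fin (n + 2) →₀ ℕ) := (Finset.range m).sigma fun r =>
    if boxHeight m w r ≤ t then Finset.finsuppAntidiag Finset.univ (t - boxHeight m w r) else ∅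
  have hU : ∀ r z, (⟨r, z⟩ : Σ _ : ℕ, Fin (n + 2) →₀ ℕ) ∈ U ↔
      r < m ∧ ∑ i : Fin (n + 1), z i.castSucc + z (Fin.last _) + boxHeight m w r = t := by
    intro r z
    simp only [U, Finset.mem_sigma, Finset.mem_range]
    refine and_congr_right fun _ => ?_
    split_ifs
    · simp only [Finset.mem_finsuppAntidiag, Finset.subset_univ, and_true, Fin.sum_univ_castSucc]
      omega
    · simp only [Finset.notMem_empty, false_iff]
      omega
  let f : (Σ _ : ℕ, Fin (n + 2) →₀ ℕ) → Fin (n + 1) → ℝ := fun p => boxPoint m w p.1 p.2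
  have himage : {x : Fin (n + 1) → ℝ | x ∈ (t : ℝ) • latticeSimplex m w ∧
      ∀ i, ∃ z : ℤ, x i = (z : ℝ)} = f '' U := by
    ext x
    constructor
    · rintro ⟨hx, hz⟩
      obtain ⟨r, hr, y, hy⟩ := exists_boxPoint_eq hm ht w x hx hz
      have := (boxPoint_mem_smul hm ht w r (Fin.snoc y 0)).1 (by rwa [hy])
      simp only [Fin.snoc_castSucc] at this
      refine ⟨⟨r, Finsupp.equivFunOnFinite.symm
        (Fin.snoc y (t - boxHeight m w r - ∑ i, y i))⟩, (hU _ _).2 ⟨hr, ?_⟩, hy _⟩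
      simp
      omega
    · rintro ⟨⟨r, z⟩, hp, rfl⟩
      obtain ⟨hr, hsum⟩ := (hU _ _).1 hp
      refine ⟨(boxPoint_mem_smul hm ht w r z).2 (by omega), Fin.lastCases ?_ fun i => ?_⟩
      · exact ⟨z (Fin.last n).castSucc * m + r, by simp [f, boxPoint]⟩
      · exact ⟨z i.castSucc.castSucc - w i * z (Fin.last n).castSucc - (w i * r / m : ℕ), by
          simp only [f, boxPoint, Fin.snoc_castSucc, Int.cast_sub, Int.cast_mul, Int.cast_natCast]⟩
  have hinj : Set.InjOn f U := by
    rintro ⟨r, z⟩ hp ⟨r', z'⟩ hp' heq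
    obtain ⟨hr, hsum⟩ := (hU _ _).1 hp
    obtain ⟨hr', hsum'⟩ := (hU _ _).1 hp'
    have hlast := congrFun heq (Fin.last n)
    simp only [f, boxPoint, Fin.snoc_last] at hlast
    have hlast : z (Fin.last n).castSucc * m + r = z' (Fin.last n).castSucc * m + r' := by
      exact_mod_cast hlast
    obtain rfl : r = r' := by
      simpa [Nat.mod_eq_of_lt hr, Nat.mod_eq_of_lt hr'] using congrArg (· % m) hlast
    have hq : z (Fin.last n).castSucc = z' (Fin.last n).castSucc :=
      Nat.eq_of_mul_eq_mul_right hm (Nat.add_right_cancel hlast)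
    have hz : ∀ j : Fin (n + 1), z j.castSucc = z' j.castSucc := by
      refine Fin.lastCases hq fun i => ?_
      have := congrFun heq i.castSucc
      simpa [f, boxPoint, hq] using this
    obtain rfl : z = z' := by
      ext j
      refine Fin.lastCases ?_ hz j
      simp only [hz] at hsum
      omega
    rfl
  rw [latticeCount, himage, hinj.ncard_image, Set.ncard_coe_finset, Finset.card_sigma]
  refine Finset.sum_congr rfl fun r _ => ?_
  split_ifs
  · rw [Finset.card_finsuppAntidiag_nat_eq_choose, Finset.card_univ, Fintype.card_fin,
      ← Nat.choose_symm_add]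
    congr 1
    omega
  · rfl

/-- The coefficient of `X ^ i` in the polynomial `7! * (X - j + 7).choose 7`. -/
def chooseCoeff : Fin 8 → Fin 8 → ℤ :=
  ![![5040, 13068, 13132, 6769, 1960, 322, 28, 1],
    ![0, 720, 1764, 1624, 735, 175, 21, 1],
    ![0, -120, -154, 49, 140, 70, 14, 1],
    ![0, 48, 28, -56, -35, 7, 7, 1],
    ![0, -36, 0, 49, 0, -14, 0, 1],
    ![0, 48, -28, -56, 35, 7, -7, 1],
    ![0, -120, 154, 49, -140, 70, -14, 1],
    ![0, 720, -1764, 1624, -735, 175, -21, 1]]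

theorem cast_choose_seven (a : ℕ) :
    (a.choose 7 : ℚ) = a * (a - 1) * (a - 2) * (a - 3) * (a - 4) * (a - 5) * (a - 6) / 5040 := by
  rw [Nat.cast_choose_eq_descPochhammer_div]
  simp [descPochhammer_succ_right, Nat.factorial]

theorem choose_eq_sum_chooseCoeff {t : ℕ} (ht : 0 < t) (j : Fin 8) :
    ((if (j : ℕ) ≤ t then (t - j + 7).choose 7 else 0 : ℕ) : ℚ) =
      (∑ i, chooseCoeff j i * (t : ℚ) ^ (i : ℕ)) / 5040 := by
  obtain ⟨s, rfl⟩ := Nat.exists_eq_add_of_lt ht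
  have h : (if (j : ℕ) ≤ 0 + s + 1 then (0 + s + 1 - j + 7).choose 7 else 0) =
      (s + (8 - j)).choose 7 := by
    split_ifs with h
    · congr 1
      omega
    · exact (Nat.choose_eq_zero_of_lt (by omega)).symm
  rw [h, cast_choose_seven]
  fin_cases j <;> simp [chooseCoeff, Fin.sum_univ_eight] <;> ring

/-- The `h*`-vector of `latticeSimplex m w`. -/
def hStar {n : ℕ} (m : ℕ) (w : Fin n → ℕ) (j : ℕ) : ℕ :=
  {r ∈ Finset.range m | boxHeight m w r = j}.card

theorem boxHeight_lt {n m r : ℕ} (hr : r < m) (w : Fin n → ℕ) : boxHeight m w r < n + 2 := by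
  have hm : 0 < m := by omega
  rw [Nat.lt_succ_iff, boxHeight_le_iff hm]
  have : ∑ i, w i * r % m ≤ n * m := by
    simpa using Finset.sum_le_card_nsmul Finset.univ (fun i => w i * r % m) m
      fun i _ => (Nat.mod_lt _ hm).le
  linarith

theorem sum_boxHeight {n m : ℕ} {R : Type*} [CommSemiring R] (w : Fin n → ℕ) (f : ℕ → R) :
    ∑ r ∈ Finset.range m, f (boxHeight m w r) = ∑ j : Fin (n + 2), hStar m w j * f j := by
  have h : ∀ r ∈ Finset.range m, f (boxHeight m w r) =
      ∑ j : Fin (n + 2), if boxHeight m w r = j then f j else 0 := fun r hr => by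
    rw [Finset.sum_eq_single ⟨_, boxHeight_lt (Finset.mem_range.1 hr) w⟩ (fun j _ hj =>
      if_neg fun h => hj (Fin.ext h.symm)) (by simp)]
    simp
  rw [Finset.sum_congr rfl h, Finset.sum_comm]
  refine Finset.sum_congr rfl fun j _ => ?_
  rw [← Finset.sum_filter, Finset.sum_const, nsmul_eq_mul, hStar]

/-- The Ehrhart polynomial of a lattice polytope of dimension seven in terms of its `h*`-vector `d`. -/
noncomputable def ehrhartPoly (d : Fin 8 → ℕ) : Polynomial ℚ :=
  ∑ i : Fin 8, Polynomial.C ((∑ j, d j * chooseCoeff j i : ℤ) / 5040 : ℚ) * Polynomial.X ^ (i : ℕ)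

theorem coeff_ehrhartPoly (d : Fin 8 → ℕ) (i : Fin 8) :
    (ehrhartPoly d).coeff i = (∑ j, d j * chooseCoeff j i : ℤ) / 5040 := by
  simp [ehrhartPoly, Polynomial.coeff_X_pow, Fin.val_inj]

theorem natDegree_ehrhartPoly_le (d : Fin 8 → ℕ) : (ehrhartPoly d).natDegree ≤ 7 :=
  Polynomial.natDegree_sum_le_of_forall_le _ _ fun i _ =>
    (Polynomial.natDegree_C_mul_X_pow_le _ _).trans (by omega)

theorem eval_ehrhartPoly {m : ℕ} (hm : 0 < m) {w : Fin 6 → ℕ} {t : ℕ} (ht : 0 < t) :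
    (latticeCount (latticeSimplex m w) t : ℚ) =
      (ehrhartPoly fun j => hStar m w j).eval (t : ℚ) := by
  rw [latticeCount_latticeSimplex hm ht, sum_boxHeight w
    (fun h => if h ≤ t then (t - h + (6 + 1)).choose (6 + 1) else 0), ehrhartPoly,
    Polynomial.eval_finsetSum, Nat.cast_sum]
  simp only [Nat.cast_mul, choose_eq_sum_chooseCoeff ht, Polynomial.eval_mul, Polynomial.eval_C,
    Polynomial.eval_pow, Polynomial.eval_X, Int.cast_sum, Int.cast_mul, Int.cast_natCast,
    Nat.cast_id, Finset.sum_div, Finset.mul_sum, Finset.sum_mul]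
  rw [Finset.sum_comm]
  exact Finset.sum_congr rfl fun i _ => Finset.sum_congr rfl fun j _ => by ring

/-- The sum of `f r` over `lo ≤ r < min m (lo + 2 ^ k)`, by bisection. -/
def bisectSum (m : ℕ) (f : ℕ → ℕ) (k : ℕ) : ℕ → ℕ :=
  Nat.rec (fun lo => cond (Nat.ble m lo) 0 (f lo))
    (fun k ih lo => cond (Nat.ble m lo) 0 (Nat.add (ih lo) (ih (Nat.add lo (Nat.pow 2 k))))) k

theorem bisectSum_eq (m : ℕ) (f : ℕ → ℕ) (k lo : ℕ) :
    bisectSum m f k lo = ∑ i ∈ Finset.range (2 ^ k), if lo + i < m then f (lo + i) else 0 := by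
  induction k generalizing lo with
  | zero =>
    by_cases h : m ≤ lo
    · simp [bisectSum, Nat.ble_eq_true_of_le h, h]
    · have : Nat.ble m lo = false := by rwa [Bool.eq_false_iff, Ne, Nat.ble_eq]
      simp [bisectSum, this, not_le.1 h]
  | succ k ih =>
    have hstep : bisectSum m f (k + 1) lo =
        cond (Nat.ble m lo) 0 (bisectSum m f k lo + bisectSum m f k (lo + 2 ^ k)) := rfl
    rw [hstep]
    by_cases h : m ≤ lo
    · rw [Nat.ble_eq_true_of_le h, cond_true]
      exact (Finset.sum_eq_zero fun i _ => if_neg (by omega)).symm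
    · have : Nat.ble m lo = false := by rwa [Bool.eq_false_iff, Ne, Nat.ble_eq]
      rw [this, cond_false, ih, ih, pow_succ, mul_two, Finset.sum_range_add]
      simp only [add_assoc]

theorem bisectSum_eq_sum_range {m k : ℕ} (hm : m ≤ 2 ^ k) (f : ℕ → ℕ) :
    bisectSum m f k 0 = ∑ r ∈ Finset.range m, f r := by
  rw [bisectSum_eq, ← Finset.sum_filter]
  refine Finset.sum_congr ?_ fun i _ => by rw [zero_add]
  ext i
  simp only [Finset.mem_filter, Finset.mem_range]
  omega

/-- The summand of the base `2 ^ 20` expansion of an `h*`-vector in dimension seven, in a form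
suited to evaluation by the kernel. -/
def heightCode (m a b c d e f r : ℕ) : ℕ :=
  Nat.pow 2 (Nat.mul 20 (Nat.div (Nat.add (Nat.add
    (Nat.add (Nat.add (Nat.add (Nat.add (Nat.add (Nat.mod (Nat.mul a r) m) (Nat.mod (Nat.mul b r) m))
      (Nat.mod (Nat.mul c r) m)) (Nat.mod (Nat.mul d r) m)) (Nat.mod (Nat.mul e r) m))
      (Nat.mod (Nat.mul f r) m)) r) (Nat.sub m 1)) m))

theorem heightCode_eq (m a b c d e f r : ℕ) :
    heightCode m a b c d e f r = (2 ^ 20) ^ boxHeight m ![a, b, c, d, e, f] r := by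
  rw [← pow_mul, boxHeight, Fin.sum_univ_six]
  rfl

theorem ofDigits_ofFn_eight (b : ℕ) (d : Fin 8 → ℕ) :
    Nat.ofDigits b (List.ofFn d) = ∑ j, d j * b ^ (j : ℕ) := by
  simp [Fin.sum_univ_eight, List.ofFn_succ, Nat.ofDigits_cons, Fin.succ]
  ring

theorem hStar_eq_of_code {m b : ℕ} (hb : 1 < b) (hm : m < b) (w : Fin 6 → ℕ) (d : Fin 8 → ℕ)
    (hd : ∀ j, d j < b)
    (h : ∑ r ∈ Finset.range m, b ^ boxHeight m w r = Nat.ofDigits b (List.ofFn d)) :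
    (fun j : Fin 8 => hStar m w j) = d := by
  rw [sum_boxHeight w (fun h => b ^ h)] at h
  refine List.ofFn_injective (Nat.ofDigits_inj_of_len_eq hb (by simp) ?_ ?_ ?_)
  · simp only [List.forall_mem_ofFn_iff]
    intro j
    have : hStar m w j ≤ m := (Finset.card_filter_le _ _).trans_eq (Finset.card_range m)
    omega
  · simpa only [List.forall_mem_ofFn_iff] using hd
  · rw [← h, ofDigits_ofFn_eight]
    simp

/-- For every choice of signs of the five middle coefficients there are a lattice simplex and its
`h*`-vector `h` for which the Ehrhart polynomial has these signs. -/
theorem exists_hStar_with_signs : ∀ s₁ s₂ s₃ s₄ s₅ : Bool,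
    ∃ (m a b c d e f : ℕ) (h : Fin 8 → ℕ), (0 < m ∧ m ≤ 2 ^ 17) ∧ (∀ j, h j < 2 ^ 20) ∧
      bisectSum m (heightCode m a b c d e f) 17 0 = Nat.ofDigits (2 ^ 20) (List.ofFn h) ∧
      ∑ j, h j * chooseCoeff j 0 = 5040 ∧
      ∀ i : Fin 7, if ![s₁, s₂, s₃, s₄, s₅, false, false] i then
        ∑ j, h j * chooseCoeff j i.succ < 0 else 0 < ∑ j, h j * chooseCoeff j i.succ
  | false, false, false, false, false => ⟨37, 11, 35, 34, 35, 2, 28, ![1, 0, 0, 6, 24, 6, 0, 0],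
      by decide +kernel⟩
  | false, false, false, false, true => ⟨97, 95, 2, 45, 94, 4, 83, ![1, 0, 1, 16, 62, 16, 1, 0],
      by decide +kernel⟩
  | false, false, false, true, false => ⟨96, 48, 22, 31, 65, 47, 74, ![1, 0, 1, 70, 24, 0, 0, 0],
      by decide +kernel⟩
  | false, false, false, true, true => ⟨214, 205, 107, 205, 107, 9, 9, ![1, 0, 0, 106, 107, 0, 0, 0],
      by decide +kernel⟩
  | false, false, true, false, false => ⟨298, 291, 2, 5, 44, 291, 297, ![1, 0, 0, 103, 92, 102, 0, 0],
      by decide +kernel⟩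
  | false, false, true, false, true => ⟨802, 730, 160, 642, 799, 5, 796, ![1, 0, 1, 220, 360, 220, 0, 0],
      by decide +kernel⟩
  | false, false, true, true, false => ⟨247, 242, 244, 0, 225, 0, 5, ![1, 0, 31, 184, 31, 0, 0, 0],
      by decide +kernel⟩
  | false, false, true, true, true => ⟨912, 760, 1, 905, 2, 911, 6, ![1, 0, 1, 322, 345, 243, 0, 0],
      by decide +kernel⟩
  | false, true, false, false, false => ⟨92, 0, 13, 0, 0, 79, 0, ![1, 0, 91, 0, 0, 0, 0, 0],
      by decide +kernel⟩
  | false, true, false, false, true => ⟨2720, 544, 2449, 2717, 2176, 1814, 2493, ![1, 0, 142, 718, 1407, 446, 6, 0],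
      by decide +kernel⟩
  | false, true, false, true, false => ⟨9870, 2692, 2326, 4935, 2970, 2159, 6024, ![1, 0, 483, 3177, 4639, 1482, 88, 0],
      by decide +kernel⟩
  | false, true, false, true, true => ⟨9776, 4888, 6519, 9171, 605, 8963, 5, ![1, 0, 429, 3110, 4749, 1453, 34, 0],
      by decide +kernel⟩
  | false, true, true, false, false => ⟨988, 984, 0, 891, 889, 754, 0, ![1, 2, 213, 571, 199, 2, 0, 0],
      by decide +kernel⟩
  | false, true, true, false, true => ⟨2990, 2, 2393, 2691, 299, 5, 2987, ![1, 0, 109, 790, 1383, 707, 0, 0],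
      by decide +kernel⟩
  | false, true, true, true, false => ⟨2991, 2841, 5, 2693, 0, 0, 2986, ![1, 0, 462, 2068, 460, 0, 0, 0],
      by decide +kernel⟩
  | false, true, true, true, true => ⟨17536, 14028, 6, 17530, 13152, 14709, 1, ![1, 0, 534, 5128, 8049, 3646, 178, 0],
      by decide +kernel⟩
  | true, false, false, false, false => ⟨300, 1, 7, 4, 4, 294, 1, ![1, 0, 50, 32, 141, 31, 45, 0],
      by decide +kernel⟩
  | true, false, false, false, true => ⟨280, 279, 40, 240, 239, 40, 240, ![1, 0, 39, 0, 240, 0, 0, 0],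
      by decide +kernel⟩
  | true, false, false, true, false => ⟨1000, 1, 250, 2, 249, 2, 748, ![1, 0, 127, 207, 457, 82, 126, 0],
      by decide +kernel⟩
  | true, false, false, true, true => ⟨913, 912, 908, 830, 1, 5, 912, ![1, 0, 0, 82, 830, 0, 0, 0],
      by decide +kernel⟩
  | true, false, true, false, false => ⟨947, 2, 943, 2, 8, 2, 2, ![1, 0, 135, 256, 164, 256, 135, 0],
      by decide +kernel⟩
  | true, false, true, false, true => ⟨32847, 24754, 32689, 30021, 13763, 27403, 20320, ![1, 2, 793, 7734, 15789, 7733, 793, 2],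
      by decide +kernel⟩
  | true, false, true, true, false => ⟨1956, 652, 6, 3, 1, 1301, 1301, ![1, 0, 174, 631, 652, 346, 152, 0],
      by decide +kernel⟩
  | true, false, true, true, true => ⟨29458, 27003, 4, 27809, 10008, 27170, 23566, ![1, 1, 718, 6994, 14161, 6878, 704, 1],
      by decide +kernel⟩
  | true, true, false, false, false => ⟨288, 0, 0, 2, 2, 284, 285, ![1, 1, 120, 48, 118, 0, 0, 0],
      by decide +kernel⟩
  | true, true, false, false, true => ⟨972, 5, 864, 108, 108, 864, 967, ![1, 0, 107, 0, 864, 0, 0, 0],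
      by decide +kernel⟩
  | true, true, false, true, false => ⟨9780, 3260, 6520, 9779, 8802, 1, 9775, ![1, 0, 572, 3419, 4975, 813, 0, 0],
      by decide +kernel⟩
  | true, true, false, true, true => ⟨9072, 4250, 2265, 4537, 6807, 4536, 906, ![1, 0, 367, 2678, 4887, 1139, 0, 0],
      by decide +kernel⟩
  | true, true, true, false, false => ⟨942, 471, 917, 25, 3, 0, 0, ![1, 0, 315, 547, 79, 0, 0, 0],
      by decide +kernel⟩
  | true, true, true, false, true => ⟨39291, 36381, 39288, 39285, 33678, 36383, 39289, ![1, 0, 1204, 10142, 18939, 8269, 736, 0],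
      by decide +kernel⟩
  | true, true, true, true, false => ⟨9375, 9372, 2501, 0, 2, 9373, 2501, ![1, 0, 751, 4041, 4039, 543, 0, 0],
      by decide +kernel⟩
  | true, true, true, true, true => ⟨37042, 37040, 2654, 33339, 18521, 31751, 3, ![1, 0, 1556, 11994, 17838, 5461, 192, 0],
      by decide +kernel⟩

/-- Every sign pattern of the middle Ehrhart coefficients is realized in
dimension 7. -/
theorem sign_pattern_dim_7 (S : Finset ℕ) (hS : S ⊆ Finset.Icc 1 5) :
    ∃ (P : Set (Fin 7 → ℝ)) (p : Polynomial ℚ),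
      IsIntegralPolytope P ∧ affineSpan ℝ P = ⊤ ∧
      p.natDegree = 7 ∧ p.coeff 0 = 1 ∧
      (∀ t : ℕ, 0 < t → (latticeCount P t : ℚ) = p.eval (t : ℚ)) ∧
      (∀ i ∈ S, p.coeff i < 0) ∧
      (∀ i ∈ Finset.Icc 1 7, i ∉ S → 0 < p.coeff i) := by
  obtain ⟨m, a, b, c, d, e, f, h, ⟨hm, hm'⟩, hlt, hcode, h0, hsign⟩ := exists_hStar_with_signs
    (decide (1 ∈ S)) (decide (2 ∈ S)) (decide (3 ∈ S)) (decide (4 ∈ S)) (decide (5 ∈ S))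
  let w : Fin 6 → ℕ := ![a, b, c, d, e, f]
  rw [bisectSum_eq_sum_range hm'] at hcode
  simp only [heightCode_eq] at hcode
  have hstar := hStar_eq_of_code (by norm_num) (hm'.trans_lt (by norm_num)) w h hlt hcode
  have hcoeff : ∀ i : Fin 7, (ehrhartPoly h).coeff (i + 1) =
      (∑ j, h j * chooseCoeff j i.succ : ℤ) / 5040 := fun i => coeff_ehrhartPoly h i.succ
  have hsign' : ∀ i : Fin 7, if (i : ℕ) + 1 ∈ S then (ehrhartPoly h).coeff (i + 1) < 0
      else 0 < (ehrhartPoly h).coeff (i + 1) := by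
    have hS6 : 6 ∉ S := fun h => by simpa using hS h
    have hS7 : 7 ∉ S := fun h => by simpa using hS h
    intro i
    have hi : ((![decide (1 ∈ S), decide (2 ∈ S), decide (3 ∈ S), decide (4 ∈ S), decide (5 ∈ S),
        false, false] i : Bool) = true) ↔ (i : ℕ) + 1 ∈ S := by
      fin_cases i <;> simp [hS6, hS7]
    have := hsign i
    simp only [hi] at this
    rw [hcoeff]
    split_ifs at this ⊢
    · exact div_neg_of_neg_of_pos (by exact_mod_cast this) (by norm_num)
    · exact div_pos (by exact_mod_cast this) (by norm_num)
  have hpos : ∀ i ∈ Finset.Icc 1 7, i ∉ S → 0 < (ehrhartPoly h).coeff i := fun i hi hiS => by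
    obtain ⟨k, rfl⟩ := Nat.exists_eq_add_of_le' (Finset.mem_Icc.1 hi).1
    simpa only [hiS, if_false] using hsign' ⟨k, by have := (Finset.mem_Icc.1 hi).2; omega⟩
  refine ⟨latticeSimplex m w, ehrhartPoly h, isIntegralPolytope_latticeSimplex m w,
    affineSpan_latticeSimplex hm w, ?_, ?_, fun t ht => ?_, fun i hi => ?_, hpos⟩
  · refine Polynomial.natDegree_eq_of_le_of_coeff_ne_zero (natDegree_ehrhartPoly_le h)
      (hpos 7 (by simp) fun h7 => ?_).ne'
    simpa using hS h7
  · have := coeff_ehrhartPoly h 0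
    rw [h0] at this
    simpa using this
  · rw [eval_ehrhartPoly hm ht, hstar]
  · have hi' := Finset.mem_Icc.1 (hS hi)
    obtain ⟨k, rfl⟩ := Nat.exists_eq_add_of_le' hi'.1
    simpa only [hi, if_true] using hsign' ⟨k, by omega⟩
end

section
/- For every subset S of {1, 2, 3, 4, 5, 6, 7} there exist a full-dimensional integral polytope P ⊆ ℝ^9 and a polynomial p of degree 9 with rational coefficients and constant coefficient 1 such that i(P,t) = p(t) for every positive integer t, the coefficient of t^i in p is negative for every i ∈ S, and the coefficient of t^i in p is positive for every i ∈ {1, 2, …, 9} \ S. -/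
open scoped Pointwise BigOperators

open Polynomial in
/-- The polynomial whose list of coefficients, in increasing degree, is `l`. -/
noncomputable def listPoly (l : List ℤ) : ℤ[X] :=
  l.foldr (fun a p => C a + X * p) 0

open Polynomial in
theorem listPoly_cons (a : ℤ) (l : List ℤ) : listPoly (a :: l) = C a + X * listPoly l := rfl

theorem coeff_listPoly (l : List ℤ) (i : ℕ) : (listPoly l).coeff i = l.getD i 0 := by
  induction l generalizing i with
  | nil => simp [listPoly]
  | cons a l ih => cases i <;> simp [listPoly_cons, Polynomial.coeff_C_succ, ih, -eq_intCast]

/-- Sum of coefficient lists. -/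
def addCoeffs : List ℤ → List ℤ → List ℤ
  | [], m => m
  | l, [] => l
  | a :: l, b :: m => (a + b) :: addCoeffs l m

/-- Coefficient list of a product of polynomials. -/
def mulCoeffs : List ℤ → List ℤ → List ℤ
  | [], _ => []
  | a :: l, m => addCoeffs (m.map (a * ·)) (0 :: mulCoeffs l m)

theorem listPoly_addCoeffs (l m : List ℤ) :
    listPoly (addCoeffs l m) = listPoly l + listPoly m := by
  induction l generalizing m with
  | nil => simp [addCoeffs, listPoly]
  | cons a l ih =>
    cases m with
    | nil => simp [addCoeffs, listPoly]
    | cons b m =>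
      simp only [addCoeffs, listPoly_cons, ih, map_add]
      ring

open Polynomial in
theorem listPoly_map_mul (a : ℤ) (l : List ℤ) :
    listPoly (l.map (a * ·)) = C a * listPoly l := by
  induction l with
  | nil => simp [listPoly]
  | cons b l ih =>
    simp only [List.map_cons, listPoly_cons, ih, map_mul]
    ring

theorem listPoly_mulCoeffs (l m : List ℤ) :
    listPoly (mulCoeffs l m) = listPoly l * listPoly m := by
  induction l with
  | nil => simp [mulCoeffs, listPoly]
  | cons a l ih =>
    simp only [mulCoeffs, listPoly_addCoeffs, listPoly_cons, listPoly_map_mul, ih, map_zero]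
    ring

/-- Some `d`-dimensional integral polytope has Ehrhart polynomial `D⁻¹ • listPoly l`. -/
def IsEhrhart (d : ℕ) (D : ℕ) (l : List ℤ) : Prop :=
  ∃ P : Set (Fin d → ℝ), IsIntegralPolytope P ∧ (interior P).Nonempty ∧
    ∀ t : ℕ, 0 < t → (D : ℤ) * latticeCount P t = (listPoly l).eval (t : ℤ)

theorem IsIntegralPolytope.image_append {a b : ℕ} {P : Set (Fin a → ℝ)} {Q : Set (Fin b → ℝ)}
    (hP : IsIntegralPolytope P) (hQ : IsIntegralPolytope Q) :
    IsIntegralPolytope (Fin.appendEquiv a b '' (P ×ˢ Q)) := by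
  classical
  obtain ⟨V, hV, rfl⟩ := hP
  obtain ⟨W, hW, rfl⟩ := hQ
  refine ⟨(V ×ˢ W).image (Fin.appendEquiv a b), ?_, ?_⟩
  · simp only [Finset.mem_image, Finset.mem_product]
    rintro _ ⟨⟨v, w⟩, ⟨hv, hw⟩, rfl⟩ i
    refine Fin.addCases (fun j => ?_) (fun j => ?_) i
    · simpa [Fin.appendEquiv] using hV v hv j
    · simpa [Fin.appendEquiv] using hW w hw j
  · let L : (Fin a → ℝ) × (Fin b → ℝ) →ₗ[ℝ] (Fin (a + b) → ℝ) :=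
      { toFun := Fin.appendEquiv a b
        map_add' := fun x y => by
          ext i
          refine Fin.addCases (fun j => ?_) (fun j => ?_) i <;> simp [Fin.appendEquiv]
        map_smul' := fun c x => by
          ext i
          refine Fin.addCases (fun j => ?_) (fun j => ?_) i <;> simp [Fin.appendEquiv] }
    rw [← convexHull_prod, Finset.coe_image, Finset.coe_product]
    exact L.image_convexHull _

theorem latticeCount_image_append {a b : ℕ} (P : Set (Fin a → ℝ)) (Q : Set (Fin b → ℝ))
    {t : ℕ} (ht : 0 < t) :
    latticeCount (Fin.appendEquiv a b '' (P ×ˢ Q)) t = latticeCount P t * latticeCount Q t := by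
  have ht' : (t : ℝ) ≠ 0 := by positivity
  unfold latticeCount
  rw [← Set.ncard_prod, ← Set.ncard_image_of_injective _ (Fin.appendEquiv a b).injective]
  congr 1
  ext x
  obtain ⟨⟨y, z⟩, rfl⟩ := (Fin.appendEquiv a b).surjective x
  have hsmul : (t : ℝ)⁻¹ • Fin.appendEquiv a b (y, z) =
      Fin.appendEquiv a b ((t : ℝ)⁻¹ • y, (t : ℝ)⁻¹ • z) := by
    ext i
    refine Fin.addCases (fun j => ?_) (fun j => ?_) i <;> simp [Fin.appendEquiv]
  have hint : (∀ i, ∃ n : ℤ, Fin.appendEquiv a b (y, z) i = (n : ℝ)) ↔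
      (∀ i, ∃ n : ℤ, y i = (n : ℝ)) ∧ ∀ i, ∃ n : ℤ, z i = (n : ℝ) := by
    rw [Fin.forall_fin_add]
    simp [Fin.appendEquiv]
  simp only [Set.mem_ofPred_eq, Set.mem_smul_set_iff_inv_smul_mem₀ ht', hsmul, hint,
    (Fin.appendEquiv a b).injective.mem_set_image, Set.mem_prod]
  tauto

theorem IsEhrhart.mul {a b D E : ℕ} {l m : List ℤ} (hl : IsEhrhart a D l)
    (hm : IsEhrhart b E m) : IsEhrhart (a + b) (D * E) (mulCoeffs l m) := by
  obtain ⟨P, hP, hPi, hPc⟩ := hl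
  obtain ⟨Q, hQ, hQi, hQc⟩ := hm
  refine ⟨_, hP.image_append hQ, ?_, fun t ht => ?_⟩
  · have h := (Fin.appendHomeomorph (X := ℝ) a b).image_interior (P ×ˢ Q)
    rw [interior_prod_eq] at h
    exact (h ▸ (hPi.prod hQi).image _ :
      (interior ((Fin.appendHomeomorph (X := ℝ) a b) '' (P ×ˢ Q))).Nonempty)
  · rw [latticeCount_image_append P Q ht, listPoly_mulCoeffs, Polynomial.eval_mul, ← hPc t ht,
      ← hQc t ht]
    push_cast
    ring

/-- A polytope with Ehrhart coefficients `l`, rescaled to have constant coefficient `1`. -/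
theorem IsEhrhart.exists_polynomial {d D : ℕ} {l : List ℤ} (h : IsEhrhart d D l) (hD : 0 < D)
    (h0 : l.getD 0 0 = D) (hlen : l.length = d + 1) (hlead : l.getD d 0 ≠ 0) :
    ∃ (P : Set (Fin d → ℝ)) (p : Polynomial ℚ),
      IsIntegralPolytope P ∧ affineSpan ℝ P = ⊤ ∧ p.natDegree = d ∧ p.coeff 0 = 1 ∧
      (∀ t : ℕ, 0 < t → (latticeCount P t : ℚ) = p.eval (t : ℚ)) ∧
      ∀ i, p.coeff i = l.getD i 0 / D := by
  obtain ⟨P, hP, hPi, hPc⟩ := h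
  have hD' : (D : ℚ) ≠ 0 := by positivity
  have hc : ∀ i, (Polynomial.C ((D : ℚ)⁻¹) * (listPoly l).map (Int.castRingHom ℚ)).coeff i =
      l.getD i 0 / D := fun i => by
    rw [Polynomial.coeff_C_mul, Polynomial.coeff_map, coeff_listPoly, div_eq_inv_mul]
    rfl
  refine ⟨P, _, hP, ?_, ?_, ?_, fun t ht => ?_, hc⟩
  · exact top_le_iff.mp ((isOpen_interior.affineSpan_eq_top hPi).symm.le.trans
      (affineSpan_mono ℝ interior_subset))
  · refine Polynomial.natDegree_eq_of_le_of_coeff_ne_zero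
      (Polynomial.natDegree_le_iff_coeff_eq_zero.mpr fun i hi => ?_) ?_
    · rw [hc, List.getD_eq_default _ _ (by omega)]
      simp
    · rw [hc]
      exact div_ne_zero (by exact_mod_cast hlead) hD'
  · rw [hc, h0]
    simpa using div_self hD'
  · have := congrArg (Int.cast : ℤ → ℚ) (hPc t ht)
    rw [Polynomial.eval_mul, Polynomial.eval_C, Polynomial.eval_natCast_map]
    push_cast at this
    rw [eq_inv_mul_iff_mul_eq₀ hD', this]
    simp

/-- The simplex with vertex `0` and the `k`-fold columns of a matrix `V`, where `A * V = N`. -/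
theorem exists_simplex {d : ℕ} (A V : Matrix (Fin d) (Fin d) ℤ) {N k : ℕ} (hN : 0 < N)
    (hk : 0 < k) (hAV : A * V = (N : ℤ) • 1) :
    ∃ P : Set (Fin d → ℝ), IsIntegralPolytope P ∧ (interior P).Nonempty ∧
      ∀ t : ℕ, 0 < t → latticeCount P t = Set.ncard {z : Fin d → ℤ |
        (∀ i, 0 ≤ A.mulVec z i) ∧ ∑ i, A.mulVec z i ≤ N * (k * t : ℕ)} := by
  classical
  let B : Matrix (Fin d) (Fin d) ℝ := A.map (Int.castRingHom ℝ)
  let W : Matrix (Fin d) (Fin d) ℝ := V.map (Int.castRingHom ℝ)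
  have hN' : (0 : ℝ) < N := by exact_mod_cast hN
  have hk' : (0 : ℝ) < k := by exact_mod_cast hk
  have hBW : B * W = (N : ℝ) • 1 := by
    have := congrArg (fun M : Matrix (Fin d) (Fin d) ℤ => M.map (Int.castRingHom ℝ)) hAV
    simp only [Matrix.map_mul] at this
    rw [this]
    ext i j
    rw [Matrix.map_apply, Matrix.smul_apply, Matrix.smul_apply, Matrix.one_apply,
      Matrix.one_apply]
    split_ifs <;> simp
  have hWB : W * B = (N : ℝ) • 1 := by
    have h1 : ((N : ℝ)⁻¹ • B) * W = 1 := by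
      rw [Matrix.smul_mul, hBW, smul_smul, inv_mul_cancel₀ hN'.ne', one_smul]
    have h2 : W * ((N : ℝ)⁻¹ • B) = 1 := mul_eq_one_comm.mp h1
    rw [Matrix.mul_smul] at h2
    rw [← h2, smul_smul, mul_inv_cancel₀ hN'.ne', one_smul]
  let P : Set (Fin d → ℝ) := {x | (∀ i, 0 ≤ B.mulVec x i) ∧ ∑ i, B.mulVec x i ≤ N * k}
  have hmem : ∀ x, x ∈ P ↔ (∀ i, 0 ≤ B.mulVec x i) ∧ ∑ i, B.mulVec x i ≤ N * k :=
    fun x => Iff.rfl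
  have hconv : Convex ℝ P := by
    intro x hx y hy a b ha hb hab
    rw [hmem] at hx hy ⊢
    simp only [Matrix.mulVec_add, Matrix.mulVec_smul, Pi.add_apply, Pi.smul_apply, smul_eq_mul,
      Finset.sum_add_distrib, ← Finset.mul_sum]
    refine ⟨fun i => add_nonneg (mul_nonneg ha (hx.1 i)) (mul_nonneg hb (hy.1 i)), ?_⟩
    calc _ ≤ a * (N * k) + b * (N * k) :=
          add_le_add (mul_le_mul_of_nonneg_left hx.2 ha) (mul_le_mul_of_nonneg_left hy.2 hb)
      _ = N * k := by rw [← add_mul, hab, one_mul]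
  let v : Option (Fin d) → Fin d → ℝ := fun o => o.elim 0 fun j i => k * W i j
  have hv : ∀ j, B.mulVec (v (some j)) = Pi.single j ((N : ℝ) * k) := by
    intro j
    have h : v (some j) = (k : ℝ) • W.mulVec (Pi.single j 1) := by
      ext i
      simp [v, Matrix.mulVec_single]
    rw [h, Matrix.mulVec_smul, Matrix.mulVec_mulVec, hBW, Matrix.smul_mulVec, Matrix.one_mulVec,
      smul_smul]
    ext i
    simp [Pi.single_apply, mul_comm]
  have hvP : ∀ o, v o ∈ P := by
    rintro (_ | j)
    · rw [hmem]
      simp only [v, Option.elim, Matrix.mulVec_zero, Pi.zero_apply, Finset.sum_const_zero]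
      exact ⟨fun _ => le_rfl, by positivity⟩
    · rw [hmem, hv]
      refine ⟨fun i => ?_, by simp⟩
      rw [Pi.single_apply]
      split_ifs <;> positivity
  refine ⟨P, ⟨Finset.univ.image v, ?_, subset_antisymm ?_ ?_⟩, ?_, ?_⟩
  · simp only [Finset.mem_image]
    rintro _ ⟨_ | j, -, rfl⟩ i
    · exact ⟨0, by simp [v]⟩
    · exact ⟨k * V i j, by simp [v, W]⟩
  · intro x hx
    rw [hmem] at hx
    let w : Option (Fin d) → ℝ := fun o =>
      o.elim (1 - ∑ i, B.mulVec x i / (N * k)) fun j => B.mulVec x j / (N * k)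
    have hxw : ∑ o, w o • v o = x := by
      have h1 : ∑ j, (B.mulVec x j / (N * k)) • v (some j) =
          (N : ℝ)⁻¹ • W.mulVec (B.mulVec x) := by
        ext i
        simp only [Finset.sum_apply, Pi.smul_apply, smul_eq_mul, Matrix.mulVec, dotProduct, v,
          Option.elim, Finset.mul_sum (s := Finset.univ) (a := (N : ℝ)⁻¹)]
        refine Finset.sum_congr rfl fun j _ => ?_
        field_simp
      rw [Fintype.sum_option]
      simp only [w, Option.elim]
      rw [h1, Matrix.mulVec_mulVec, hWB, Matrix.smul_mulVec, Matrix.one_mulVec, smul_smul,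
        inv_mul_cancel₀ hN'.ne', one_smul]
      simp [v]
    rw [← hxw]
    refine (convex_convexHull ℝ _).sum_mem ?_ ?_ fun o _ => subset_convexHull ℝ _ (by simp)
    · rintro (_ | j) -
      · simp only [w, Option.elim]
        rw [sub_nonneg, ← Finset.sum_div, div_le_one (by positivity)]
        exact hx.2
      · exact div_nonneg (hx.1 j) (by positivity)
    · rw [Fintype.sum_option]
      simp [w]
  · refine convexHull_min ?_ hconv
    rintro _ hx
    obtain ⟨o, -, rfl⟩ := Finset.mem_image.mp (Finset.mem_coe.mp hx)
    exact hvP o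
  · let U : Set (Fin d → ℝ) := {x | (∀ i, 0 < B.mulVec x i) ∧ ∑ i, B.mulVec x i < N * k}
    have hB : Continuous fun x : Fin d → ℝ => B.mulVec x := by fun_prop
    have hU : IsOpen U := by
      refine IsOpen.and ?_ (isOpen_lt (by fun_prop) continuous_const)
      simp only [Set.ofPred_forall]
      exact isOpen_iInter_of_finite fun i => isOpen_lt continuous_const (by fun_prop)
    have hUP : U ⊆ P := fun x hx => ⟨fun i => (hx.1 i).le, hx.2.le⟩
    refine ⟨W.mulVec fun _ => (k : ℝ) / (d + 1), interior_maximal hUP hU ?_⟩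
    have h : B.mulVec (W.mulVec fun _ => (k : ℝ) / (d + 1)) = fun _ => (N : ℝ) * (k / (d + 1)) := by
      rw [Matrix.mulVec_mulVec, hBW, Matrix.smul_mulVec, Matrix.one_mulVec]
      rfl
    show (∀ i, 0 < _) ∧ _ < _
    rw [h]
    refine ⟨fun _ => by positivity, ?_⟩
    rw [Finset.sum_const, Finset.card_univ, Fintype.card_fin, nsmul_eq_mul, ← mul_div_assoc,
      ← mul_div_assoc, div_lt_iff₀ (by positivity)]
    have : (0 : ℝ) < N * k := by positivity
    nlinarith
  · intro t ht
    have ht' : (0 : ℝ) < t := by exact_mod_cast ht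
    let e : (Fin d → ℤ) → Fin d → ℝ := fun z i => z i
    have he : Function.Injective e := fun y z h => by
      ext i
      exact Int.cast_injective (congrFun h i)
    unfold latticeCount
    rw [← Set.ncard_image_of_injective _ he]
    congr 1
    have key : ∀ z : Fin d → ℤ, e z ∈ (t : ℝ) • P ↔
        (∀ i, 0 ≤ A.mulVec z i) ∧ ∑ i, A.mulVec z i ≤ N * (k * t : ℕ) := by
      intro z
      have hz : ∀ i, B.mulVec (e z) i = (A.mulVec z i : ℤ) := fun i => by
        simp [Matrix.mulVec, dotProduct, B, e]
      rw [Set.mem_smul_set_iff_inv_smul_mem₀ ht'.ne', hmem, Matrix.mulVec_smul]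
      simp only [Pi.smul_apply, smul_eq_mul, hz, ← Finset.mul_sum]
      refine and_congr (forall_congr' fun i => ?_) ?_
      · rw [mul_nonneg_iff_of_pos_left (by positivity)]
        norm_cast
      · rw [inv_mul_le_iff₀ ht']
        have : (t : ℝ) * (N * k) = ((N * (k * t : ℕ) : ℤ) : ℝ) := by
          push_cast
          ring
        rw [this]
        norm_cast
    ext x
    constructor
    · rintro ⟨hx, hi⟩
      choose z hz using hi
      obtain rfl : x = e z := funext hz
      exact ⟨z, (key z).mp hx, rfl⟩
    · rintro ⟨z, hz, rfl⟩
      exact ⟨(key z).mpr hz, fun i => ⟨z i, rfl⟩⟩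

/-- Pairs `(u, x)` of natural numbers with `u + x < n`. -/
def trianglePoints (n : ℕ) : Finset (Σ _ : ℕ, ℕ) :=
  (Finset.range n).sigma fun u => Finset.range (n - u)

/-- Triples `(u, (x, y))` of natural numbers with `u + x + y < n`. -/
def tetrahedronPoints (n : ℕ) : Finset (Σ _ : ℕ, Σ _ : ℕ, ℕ) :=
  (Finset.range n).sigma fun u => trianglePoints (n - u)

theorem two_mul_card_trianglePoints (n : ℕ) :
    2 * (trianglePoints n).card = n * (n + 1) := by
  induction n with
  | zero => rfl
  | succ n ih =>
    simp only [trianglePoints, Finset.card_sigma, Finset.card_range] at ih ⊢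
    simp only [Finset.sum_range_succ', Nat.add_sub_add_right, mul_add, ih]
    simp
    ring

theorem six_mul_card_tetrahedronPoints (n : ℕ) :
    6 * (tetrahedronPoints n).card = n * (n + 1) * (n + 2) := by
  induction n with
  | zero => rfl
  | succ n ih =>
    simp only [tetrahedronPoints, Finset.card_sigma] at ih ⊢
    simp only [Finset.sum_range_succ', Nat.add_sub_add_right, mul_add, ih]
    have := two_mul_card_trianglePoints (n + 1)
    simp only [Nat.sub_zero]
    linear_combination 3 * this

theorem isEhrhart_segment {n : ℕ} (hn : 0 < n) : IsEhrhart 1 1 [1, n] := by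
  obtain ⟨P, hP, hPi, hPc⟩ := exists_simplex !![1] !![(n : ℤ)] hn one_pos (by
    ext i j
    fin_cases i; fin_cases j; simp)
  refine ⟨P, hP, hPi, fun t ht => ?_⟩
  have hset : {z : Fin 1 → ℤ | (∀ i, 0 ≤ (!![1] : Matrix (Fin 1) (Fin 1) ℤ).mulVec z i) ∧
      ∑ i, (!![1] : Matrix (Fin 1) (Fin 1) ℤ).mulVec z i ≤ n * (1 * t : ℕ)} =
      (fun c _ => c) '' (Finset.Icc (0 : ℤ) (n * t) : Set ℤ) := by
    ext z
    have hz : z = fun _ => z 0 := funext fun i => by rw [Subsingleton.elim i 0]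
    simp only [Set.mem_ofPred_eq, Fin.forall_fin_one, Fin.sum_univ_one, Set.mem_image,
      Finset.coe_Icc, Set.mem_Icc]
    simp only [Matrix.mulVec, dotProduct, Fin.sum_univ_one, Matrix.of_apply, Matrix.cons_val_zero,
      one_mul]
    exact ⟨fun h => ⟨z 0, h, hz.symm⟩, by rintro ⟨c, h, rfl⟩; exact h⟩
  rw [hPc t ht, hset, Set.ncard_image_of_injective _ fun x y h => congrFun h 0,
    Set.ncard_coe_finset, Int.card_Icc]
  simp only [listPoly, List.foldr, Polynomial.eval_add, Polynomial.eval_mul, Polynomial.eval_C,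
    Polynomial.eval_X, Polynomial.eval_zero]
  have : (0 : ℤ) ≤ n * t := by positivity
  push_cast
  rw [Int.toNat_of_nonneg (by omega)]
  ring

theorem mem_trianglePoints {n : ℕ} {p : Σ _ : ℕ, ℕ} :
    p ∈ trianglePoints n ↔ p.1 + p.2 < n := by
  simp only [trianglePoints, Finset.mem_sigma, Finset.mem_range]
  omega

theorem mem_tetrahedronPoints {n : ℕ} {p : Σ _ : ℕ, Σ _ : ℕ, ℕ} :
    p ∈ tetrahedronPoints n ↔ p.1 + p.2.1 + p.2.2 < n := by
  simp only [tetrahedronPoints, Finset.mem_sigma, Finset.mem_range, mem_trianglePoints]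
  omega

theorem eq_and_eq_of_mul_add_eq {N u r u' r' : ℕ} (hr : r < N) (hr' : r' < N)
    (h : (N : ℤ) * u + r = N * u' + r') : u = u' ∧ r = r' := by
  have h' : N * u + r = N * u' + r' := by exact_mod_cast h
  have hq := congrArg (· / N) h'
  have hm := congrArg (· % N) h'
  simpa [Nat.mul_add_div hr.pos, Nat.div_eq_of_lt, Nat.mod_eq_of_lt, hr, hr'] using
    And.intro hq hm

theorem ncard_triangle (h s : ℕ) :
    (2 : ℤ) * Set.ncard {z : Fin 2 → ℤ |
      (∀ i, 0 ≤ (!![2 * (h : ℤ) + 1, 1; 0, 1]).mulVec z i) ∧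
        ∑ i, (!![2 * (h : ℤ) + 1, 1; 0, 1]).mulVec z i ≤ ((2 * h + 1 : ℕ) : ℤ) * s} =
      2 + 3 * s + (2 * h + 1) * s ^ 2 := by
  let age : ℕ → ℕ := fun r => if r = 0 then 0 else if r ≤ h then 1 else 2
  let F := (Finset.range (2 * h + 1)).sigma fun r => trianglePoints (s + 1 - age r)
  let f : (Σ _ : ℕ, Σ _ : ℕ, ℕ) → Fin 2 → ℤ := fun p =>
    ![p.2.2 - p.2.1, (2 * h + 1) * p.2.1 + p.1]
  have hset : {z : Fin 2 → ℤ |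
      (∀ i, 0 ≤ (!![2 * (h : ℤ) + 1, 1; 0, 1]).mulVec z i) ∧
        ∑ i, (!![2 * (h : ℤ) + 1, 1; 0, 1]).mulVec z i ≤ ((2 * h + 1 : ℕ) : ℤ) * s} = f '' F := by
    ext z
    simp only [Set.mem_ofPred_eq, Fin.forall_fin_two, Fin.sum_univ_two, Set.mem_image,
      Matrix.mulVec, dotProduct, Matrix.of_apply, Matrix.cons_val_zero, Matrix.cons_val_one,
      zero_mul, one_mul, zero_add, Finset.mem_coe, F, Finset.mem_sigma, Finset.mem_range,
      mem_trianglePoints]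
    constructor
    · rintro ⟨⟨hx, hc⟩, hs⟩
      obtain ⟨c, hc'⟩ := Int.eq_ofNat_of_zero_le hc
      have hdm : ((2 * h + 1 : ℕ) : ℤ) * (c / (2 * h + 1) : ℕ) + (c % (2 * h + 1) : ℕ) = c := by
        exact_mod_cast Nat.div_add_mod c (2 * h + 1)
      have hlt : c % (2 * h + 1) < 2 * h + 1 := Nat.mod_lt _ (by omega)
      generalize c / (2 * h + 1) = u at hdm
      generalize c % (2 * h + 1) = r at hdm hlt
      push_cast at hdm hs
      have hx' : 0 ≤ z 0 + u := by
        by_contra hneg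
        nlinarith
      obtain ⟨x, hx''⟩ := Int.eq_ofNat_of_zero_le hx'
      refine ⟨⟨r, u, x⟩, ⟨hlt, ?_⟩, ?_⟩
      · have hz : (2 * h + 1 : ℤ) * (u + x) + 2 * r ≤ (2 * h + 1) * s := by
          rw [← hx'']
          linarith
        have : ((u + x + age r : ℕ) : ℤ) < s + 1 := by
          simp only [age]
          split_ifs with h1 h2 <;> push_cast <;> by_contra hneg
          · nlinarith
          · have : 0 < r := Nat.pos_of_ne_zero h1
            nlinarith
          · nlinarith
        simp only
        omega
      · ext i
        fin_cases i
        · simp [f]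
          linarith
        · simp [f]
          linarith
    · rintro ⟨⟨r, u, x⟩, ⟨hr, hux⟩, rfl⟩
      simp only [f, Matrix.cons_val_zero, Matrix.cons_val_one] at hux ⊢
      have hage : (2 * r : ℤ) ≤ (2 * h + 1) * age r := by
        simp only [age]
        split_ifs <;> push_cast <;> linarith
      have hux' : (u + x + age r : ℤ) ≤ s := by omega
      have := mul_le_mul_of_nonneg_left hux' (by positivity : (0 : ℤ) ≤ 2 * h + 1)
      have hx : (0 : ℤ) ≤ (2 * h + 1) * x := by positivity
      refine ⟨⟨?_, by positivity⟩, ?_⟩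
      · linarith
      · push_cast
        linarith
  have hinj : Set.InjOn f F := by
    rintro ⟨r, u, x⟩ hp ⟨r', u', x'⟩ hp' heq
    simp only [Finset.mem_coe, F, Finset.mem_sigma, Finset.mem_range] at hp hp'
    have e0 := congrFun heq 0
    have e1 := congrFun heq 1
    simp only [f, Matrix.cons_val_zero, Matrix.cons_val_one] at e0 e1
    obtain ⟨rfl, rfl⟩ := eq_and_eq_of_mul_add_eq hp.1 hp'.1 (by push_cast; exact e1)
    obtain rfl : x = x' := by omega
    rfl
  have hsum : ∀ g : ℕ → ℕ, ∑ r ∈ Finset.range (2 * h + 1), g (age r) =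
      g 0 + h * g 1 + h * g 2 := by
    intro g
    have h1 : ∀ r ∈ Finset.range h, g (age (r + 1)) = g 1 := fun r hr => by
      have := Finset.mem_range.mp hr
      simp only [age]
      rw [if_neg (by omega), if_pos (by omega)]
    have h2 : ∀ r ∈ Finset.range h, g (age (h + r + 1)) = g 2 := fun r _ => by
      simp only [age]
      rw [if_neg (by omega), if_neg (by omega)]
    rw [Finset.sum_range_succ', two_mul, Finset.sum_range_add, Finset.sum_congr rfl h1,
      Finset.sum_congr rfl h2]
    simp [age]
    ring
  rw [hset, hinj.ncard_image, Set.ncard_coe_finset, Finset.card_sigma,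
    hsum fun a => (trianglePoints (s + 1 - a)).card]
  have h0 := two_mul_card_trianglePoints (s + 1)
  have h1 := two_mul_card_trianglePoints s
  have h2 := two_mul_card_trianglePoints (s - 1)
  have h2' : ((s - 1 : ℕ) : ℤ) * ((s - 1 : ℕ) + 1) = s * (s - 1) := by
    cases s with
    | zero => simp
    | succ n =>
      rw [Nat.add_sub_cancel]
      push_cast
      ring
  zify at h0 h1 h2
  rw [h2'] at h2
  rw [Nat.sub_zero, Nat.add_sub_cancel, show s + 1 - 2 = s - 1 by omega]
  push_cast
  linear_combination h0 + h * h1 + h * h2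

theorem ncard_reeve (m s : ℕ) :
    (6 : ℤ) * Set.ncard {z : Fin 3 → ℤ |
      (∀ i, 0 ≤ (!![(m : ℤ) + 1, 0, -1; 0, m + 1, -1; 0, 0, 1]).mulVec z i) ∧
        ∑ i, (!![(m : ℤ) + 1, 0, -1; 0, m + 1, -1; 0, 0, 1]).mulVec z i ≤
          ((m + 1 : ℕ) : ℤ) * s} =
      6 + (11 - m) * s + 6 * s ^ 2 + (1 + m) * s ^ 3 := by
  let age : ℕ → ℕ := fun r => if r = 0 then 0 else 1
  let F := (Finset.range (m + 1)).sigma fun r => tetrahedronPoints (s + 1 - 2 * age r)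
  let f : (Σ _ : ℕ, Σ _ : ℕ, Σ _ : ℕ, ℕ) → Fin 3 → ℤ := fun p =>
    ![p.2.2.1 + p.2.1 + age p.1, p.2.2.2 + p.2.1 + age p.1, (m + 1) * p.2.1 + p.1]
  have hset : {z : Fin 3 → ℤ |
      (∀ i, 0 ≤ (!![(m : ℤ) + 1, 0, -1; 0, m + 1, -1; 0, 0, 1]).mulVec z i) ∧
        ∑ i, (!![(m : ℤ) + 1, 0, -1; 0, m + 1, -1; 0, 0, 1]).mulVec z i ≤
          ((m + 1 : ℕ) : ℤ) * s} = f '' F := by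
    ext z
    simp only [Set.mem_ofPred_eq, Fin.forall_fin_succ, Fin.sum_univ_three, Set.mem_image,
      Matrix.mulVec, dotProduct, Matrix.of_apply, Matrix.cons_val, Fin.succ_zero_eq_one,
      Fin.succ_one_eq_two, IsEmpty.forall_iff, and_true,
      zero_mul, one_mul, zero_add, add_zero, neg_mul, Finset.mem_coe, F, Finset.mem_sigma,
      Finset.mem_range, mem_tetrahedronPoints]
    constructor
    · rintro ⟨⟨hx, hy, hc⟩, hs⟩
      obtain ⟨c, hc'⟩ := Int.eq_ofNat_of_zero_le hc
      have hdm : ((m + 1 : ℕ) : ℤ) * (c / (m + 1) : ℕ) + (c % (m + 1) : ℕ) = c := by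
        exact_mod_cast Nat.div_add_mod c (m + 1)
      have hlt : c % (m + 1) < m + 1 := Nat.mod_lt _ (by omega)
      generalize c / (m + 1) = u at hdm
      generalize c % (m + 1) = r at hdm hlt
      push_cast at hdm hs
      have hround : ∀ w : ℤ, 0 ≤ (m + 1) * w + -z 2 → 0 ≤ w - u - age r := by
        intro w hw
        simp only [age]
        split_ifs with h1 <;> push_cast <;> by_contra hneg
        · nlinarith
        · have : 0 < r := Nat.pos_of_ne_zero h1
          nlinarith
      obtain ⟨x, hx'⟩ := Int.eq_ofNat_of_zero_le (hround _ hx)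
      obtain ⟨y, hy'⟩ := Int.eq_ofNat_of_zero_le (hround _ hy)
      refine ⟨⟨r, u, x, y⟩, ⟨hlt, ?_⟩, ?_⟩
      · have hz : (m + 1 : ℤ) * (u + x + y + 2 * age r) ≤ (m + 1) * s + r := by
          rw [← hx', ← hy']
          linarith
        have : ((u + x + y + 2 * age r : ℕ) : ℤ) < s + 1 := by
          push_cast
          by_contra hneg
          nlinarith
        simp only
        omega
      · ext i
        fin_cases i
        · simp [f]
          linarith
        · simp [f]
          linarith
        · simp [f]
          linarith
    · rintro ⟨⟨r, u, x, y⟩, ⟨hr, huxy⟩, rfl⟩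
      simp only [f, Matrix.cons_val] at huxy ⊢
      have hage : (r : ℤ) ≤ (m + 1) * age r := by
        simp only [age]
        split_ifs <;> push_cast <;> linarith
      have huxy' : (u + x + y + 2 * age r : ℤ) ≤ s := by omega
      have := mul_le_mul_of_nonneg_left huxy' (by positivity : (0 : ℤ) ≤ m + 1)
      have hx : (0 : ℤ) ≤ (m + 1) * x := by positivity
      have hy : (0 : ℤ) ≤ (m + 1) * y := by positivity
      refine ⟨⟨by linarith, by linarith, by positivity⟩, ?_⟩
      push_cast
      linarith
  have hinj : Set.InjOn f F := by
    rintro ⟨r, u, x, y⟩ hp ⟨r', u', x', y'⟩ hp' heq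
    simp only [Finset.mem_coe, F, Finset.mem_sigma, Finset.mem_range] at hp hp'
    have e0 := congrFun heq 0
    have e1 := congrFun heq 1
    have e2 := congrFun heq 2
    simp only [f, Matrix.cons_val] at e0 e1 e2
    obtain ⟨rfl, rfl⟩ := eq_and_eq_of_mul_add_eq hp.1 hp'.1 (by push_cast; exact e2)
    obtain rfl : x = x' := by omega
    obtain rfl : y = y' := by omega
    rfl
  rw [hset, hinj.ncard_image, Set.ncard_coe_finset, Finset.card_sigma, Finset.sum_range_succ']
  have h0 := six_mul_card_tetrahedronPoints (s + 1)
  have h1 := six_mul_card_tetrahedronPoints (s - 1)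
  have h1' : ((s - 1 : ℕ) : ℤ) * ((s - 1 : ℕ) + 1) * ((s - 1 : ℕ) + 2) =
      (s - 1) * s * (s + 1) := by
    cases s with
    | zero => simp
    | succ n =>
      rw [Nat.add_sub_cancel]
      push_cast
      ring
  zify at h0 h1
  rw [h1'] at h1
  simp only [age, Nat.add_eq_zero_iff, one_ne_zero, and_false, if_false, if_true,
    Finset.sum_const, Finset.card_range, smul_eq_mul, mul_one, mul_zero, Nat.sub_zero,
    show s + 1 - 2 = s - 1 by omega]
  push_cast
  linear_combination h0 + m * h1

theorem isEhrhart_triangle (h : ℕ) {k : ℕ} (hk : 0 < k) :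
    IsEhrhart 2 2 [2, 3 * k, (2 * h + 1) * k ^ 2] := by
  obtain ⟨P, hP, hPi, hPc⟩ := exists_simplex !![2 * (h : ℤ) + 1, 1; 0, 1]
    !![1, -1; 0, 2 * (h : ℤ) + 1] (Nat.succ_pos (2 * h)) hk (by
      ext i j
      fin_cases i <;> fin_cases j <;> simp)
  refine ⟨P, hP, hPi, fun t ht => ?_⟩
  have := ncard_triangle h (k * t)
  rw [hPc t ht]
  simp only [listPoly, List.foldr, Polynomial.eval_add, Polynomial.eval_mul, Polynomial.eval_C,
    Polynomial.eval_X, Polynomial.eval_zero]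
  refine this.trans ?_
  push_cast
  ring

/-- Dilated Reeve tetrahedra. -/
theorem isEhrhart_reeve (m : ℕ) {k : ℕ} (hk : 0 < k) :
    IsEhrhart 3 6 [6, (11 - m) * k, 6 * k ^ 2, (1 + m) * k ^ 3] := by
  obtain ⟨P, hP, hPi, hPc⟩ := exists_simplex
    !![(m : ℤ) + 1, 0, -1; 0, m + 1, -1; 0, 0, 1]
    !![1, 0, 1; 0, 1, 1; 0, 0, (m : ℤ) + 1] (Nat.succ_pos m) hk (by
      ext i j
      fin_cases i <;> fin_cases j <;> simp [Matrix.mul_apply, Fin.sum_univ_three])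
  refine ⟨P, hP, hPi, fun t ht => ?_⟩
  have := ncard_reeve m (k * t)
  rw [hPc t ht]
  simp only [listPoly, List.foldr, Polynomial.eval_add, Polynomial.eval_mul, Polynomial.eval_C,
    Polynomial.eval_X, Polynomial.eval_zero]
  refine this.trans ?_
  push_cast
  ring

/-- Coefficients of a scaled product of two Reeve tetrahedra, a triangle and a segment. -/
def reeveProduct : ℕ × ℕ × ℕ × ℕ × ℕ × ℕ × ℕ → List ℤ
  | (m₁, k₁, m₂, k₂, h, k₃, n) =>
    mulCoeffs
      (mulCoeffs
        (mulCoeffs [6, (11 - m₁) * k₁, 6 * k₁ ^ 2, (1 + m₁) * k₁ ^ 3]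
          [6, (11 - m₂) * k₂, 6 * k₂ ^ 2, (1 + m₂) * k₂ ^ 3])
        [2, 3 * k₃, (2 * h + 1) * k₃ ^ 2])
      [1, n]

/-- Coefficients of a scaled product of a Reeve tetrahedron and three triangles, whose negative
coefficients are those of degree `1`, `3`, `5` and `7`. -/
def alternatingProduct : List ℤ :=
  mulCoeffs (mulCoeffs (mulCoeffs [6, (11 - 39 : ℤ), 6, 1 + 39] [2, 3, 2 * 14 + 1])
    [2, 3, 2 * 11 + 1]) [2, 3, 2 * 12 + 1]

/-- Bit `i` of `s` tells whether the coefficient of degree `i + 1` is negative. -/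
def HasSigns (D : ℕ) (l : List ℤ) (s : ℕ) : Prop :=
  l.length = 10 ∧ l.getD 0 0 = D ∧ 0 < l.getD 8 0 ∧ 0 < l.getD 9 0 ∧
    ∀ i < 7, if s.testBit i then l.getD (i + 1) 0 < 0 else 0 < l.getD (i + 1) 0

instance (D : ℕ) (l : List ℤ) (s : ℕ) : Decidable (HasSigns D l s) := by
  unfold HasSigns
  infer_instance

/-- Entry `s` holds parameters of `reeveProduct` realizing the sign pattern `s`; entry `85` is a
placeholder, as that pattern is realized by `alternatingProduct`. -/
def signTable : List (ℕ × ℕ × ℕ × ℕ × ℕ × ℕ × ℕ) :=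
  [(0, 1, 0, 1, 0, 1, 1), (18, 4, 0, 1, 0, 1, 1), (0, 1, 20, 2, 0, 1, 1), (0, 1, 25, 2, 0, 1, 1),
   (21, 2, 0, 1, 0, 6, 1), (0, 1, 23, 3, 8, 2, 1), (0, 1, 24, 1, 0, 1, 1),
   (38, 1, 0, 1, 0, 1, 1), (23, 1, 0, 5, 0, 1, 1), (9, 3, 24, 2, 0, 1, 1),
   (0, 1, 27, 2, 13, 1, 5), (6, 5, 26, 3, 0, 1, 1), (26, 1, 0, 1, 1, 2, 1),
   (29, 2, 0, 1, 6, 2, 1), (0, 2, 30, 1, 0, 1, 1), (38, 1, 0, 1, 1, 1, 1),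
   (23, 1, 0, 11, 0, 1, 2), (14, 2, 21, 1, 0, 1, 1), (28, 1, 6, 2, 0, 1, 2),
   (14, 1, 24, 1, 0, 1, 1), (7, 13, 27, 7, 0, 30, 1), (32, 288, 12, 375, 2, 311, 1),
   (39, 2, 9, 2, 0, 1, 8), (10, 3, 137, 4, 0, 1, 5), (0, 8, 28, 1, 0, 1, 1),
   (27, 1, 11, 2, 0, 1, 1), (32, 2, 5, 6, 0, 1, 1), (31, 1, 9, 2, 0, 1, 1),
   (30, 1, 0, 2, 1, 3, 1), (0, 1, 41, 1, 14, 1, 1), (0, 4, 50, 1, 0, 1, 1),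
   (61, 1, 1, 2, 1, 1, 1), (0, 15, 22, 1, 1, 3, 1), (20, 1, 19, 2, 1, 2, 1),
   (21, 1, 17, 1, 0, 2, 2), (21, 2, 19, 1, 1, 2, 1), (23, 1, 15, 1, 1, 2, 1),
   (28, 1, 15, 1, 3, 1, 1), (13, 1, 30, 1, 0, 3, 1), (35, 1, 12, 1, 1, 2, 1),
   (0, 32, 26, 2, 4, 2, 1), (27, 2, 20, 2, 6, 1, 1), (15, 1, 32, 1, 3, 1, 3),
   (16, 4, 32, 4, 9, 2, 5), (36, 1, 10, 1, 1, 4, 1), (12, 1, 32, 1, 6, 1, 1),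
   (9, 2, 50, 2, 0, 11, 1), (48, 1, 10, 1, 1, 2, 1), (25, 1, 0, 16, 1, 2, 1),
   (30, 1, 13, 3, 0, 2, 1), (28, 1, 10, 2, 0, 2, 2), (29, 1, 25, 1, 0, 1, 1),
   (7, 2, 30, 1, 0, 4, 1), (12, 3, 31, 2, 2, 3, 1), (9, 2, 32, 1, 0, 3, 1),
   (13, 1, 54, 1, 0, 1, 2), (32, 1, 0, 4, 1, 4, 2), (36, 1, 35, 1, 0, 1, 1),
   (37, 1, 7, 3, 0, 1, 3), (21, 1, 38, 1, 0, 1, 1), (0, 10, 44, 1, 2, 1, 1),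
   (60, 1, 0, 3, 40, 1, 1), (0, 9, 67, 1, 0, 2, 1), (0, 3, 69, 1, 4, 2, 1),
   (0, 17, 23, 1, 3, 2, 5), (22, 1, 19, 3, 5, 1, 3), (19, 1, 20, 1, 3, 1, 5),
   (21, 1, 21, 2, 5, 1, 3), (20, 1, 17, 1, 1, 4, 2), (18, 1, 23, 2, 14, 1, 2),
   (19, 1, 22, 3, 0, 6, 5), (16, 1, 35, 2, 4, 2, 2), (13, 1, 23, 1, 1, 4, 3),
   (22, 9, 12, 1, 89, 2, 13), (26, 1, 14, 1, 5, 1, 3), (47, 2, 16, 1, 6, 1, 10),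
   (27, 1, 12, 1, 2, 4, 2), (35, 1, 11, 1, 11, 1, 2), (12, 1, 32, 1, 2, 2, 3),
   (43, 1, 11, 1, 5, 1, 3), (0, 26, 26, 1, 5, 1, 4), (24, 1, 18, 6, 4, 1, 4),
   (13, 2, 27, 1, 3, 1, 10), (24, 1, 28, 3, 3, 1, 5), (4, 1001, 36, 240, 105382, 1, 256895),
   (0, 1, 0, 1, 0, 1, 1), (277, 4, 15, 2, 11, 1, 10549), (422, 4, 15, 2, 12, 1, 37),
   (5, 4, 31, 2, 37, 1, 13), (30, 7, 14, 13, 40, 2, 14), (7, 1, 49, 1, 18, 1, 21),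
   (27, 4, 24, 3, 20, 1, 7), (8, 1, 53, 1, 6, 3, 3), (71, 2, 8, 2, 112, 1, 4),
   (11, 1, 56, 1, 3, 1, 7), (65, 1, 9, 1, 8, 1, 3), (0, 29, 33, 1, 6, 2, 1),
   (16, 2, 32, 1, 2, 2, 2), (21, 2, 26, 1, 1, 2, 3), (21, 1, 27, 1, 3, 1, 2),
   (21, 1, 18, 1, 1, 3, 2), (27, 1, 23, 1, 2, 2, 1), (16, 1, 39, 1, 0, 5, 2),
   (17, 1, 36, 1, 1, 2, 2), (28, 1, 8, 2, 1, 3, 5), (33, 1, 13, 3, 9, 1, 1),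
   (17, 1, 27, 1, 4, 1, 3), (16, 1, 34, 1, 3, 1, 3), (30, 1, 13, 1, 3, 2, 2),
   (45, 1, 13, 1, 5, 2, 1), (30, 1, 15, 1, 1, 2, 4), (46, 1, 13, 1, 1, 2, 3),
   (1, 10, 28, 1, 1, 3, 4), (66, 1, 28, 2, 1, 2, 1), (34, 1, 32, 1, 1, 1, 6),
   (18, 2, 36, 1, 1, 2, 2), (38, 1, 11, 2, 2, 4, 1), (14, 2, 39, 1, 3, 2, 1),
   (15, 2, 41, 1, 0, 10, 1), (48, 1, 16, 2, 1, 3, 1), (0, 54, 39, 1, 1, 2, 2),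
   (25, 2, 36, 1, 3, 1, 2), (90, 1, 11, 6, 0, 2, 12), (12, 3, 48, 1, 2, 1, 5),
   (52, 1, 1, 9, 0, 7, 2), (9, 2, 48, 1, 5, 2, 1), (66, 1, 1, 7, 4, 1, 3),
   (87, 1, 6, 2, 1, 3, 2)]

theorem signTable_spec : ∀ s < 128, s ≠ 85 →
    match signTable.getD s (0, 0, 0, 0, 0, 0, 0) with
    | (m₁, k₁, m₂, k₂, h, k₃, n) => 0 < k₁ ∧ 0 < k₂ ∧ 0 < k₃ ∧ 0 < n ∧
      HasSigns 72 (reeveProduct (m₁, k₁, m₂, k₂, h, k₃, n)) s := by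
  decide +kernel

theorem isEhrhart_reeveProduct (m₁ m₂ h : ℕ) {k₁ k₂ k₃ n : ℕ} (hk₁ : 0 < k₁) (hk₂ : 0 < k₂)
    (hk₃ : 0 < k₃) (hn : 0 < n) :
    IsEhrhart 9 72 (reeveProduct (m₁, k₁, m₂, k₂, h, k₃, n)) :=
  (((isEhrhart_reeve m₁ hk₁).mul (isEhrhart_reeve m₂ hk₂)).mul (isEhrhart_triangle h hk₃)).mul
    (isEhrhart_segment hn)

theorem isEhrhart_alternatingProduct : IsEhrhart 9 48 alternatingProduct :=
  (((isEhrhart_reeve 39 one_pos).mul (isEhrhart_triangle 14 one_pos)).mul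
    (isEhrhart_triangle 11 one_pos)).mul (isEhrhart_triangle 12 one_pos)

theorem exists_isEhrhart_hasSigns {s : ℕ} (hs : s < 128) :
    ∃ D l, 0 < D ∧ IsEhrhart 9 D l ∧ HasSigns D l s := by
  by_cases h85 : s = 85
  · subst h85
    exact ⟨48, _, by norm_num, isEhrhart_alternatingProduct, by decide +kernel⟩
  · have hspec := signTable_spec s hs h85
    generalize signTable.getD s (0, 0, 0, 0, 0, 0, 0) = params at hspec
    obtain ⟨m₁, k₁, m₂, k₂, h, k₃, n⟩ := params
    obtain ⟨hk₁, hk₂, hk₃, hn, hsigns⟩ := hspec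
    exact ⟨72, _, by norm_num, isEhrhart_reeveProduct m₁ m₂ h hk₁ hk₂ hk₃ hn, hsigns⟩

/-- Every sign pattern of the middle Ehrhart coefficients is realized in
dimension 9. -/
theorem sign_pattern_dim_9 (S : Finset ℕ) (hS : S ⊆ Finset.Icc 1 7) :
    ∃ (P : Set (Fin 9 → ℝ)) (p : Polynomial ℚ),
      IsIntegralPolytope P ∧ affineSpan ℝ P = ⊤ ∧
      p.natDegree = 9 ∧ p.coeff 0 = 1 ∧
      (∀ t : ℕ, 0 < t → (latticeCount P t : ℚ) = p.eval (t : ℚ)) ∧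
      (∀ i ∈ S, p.coeff i < 0) ∧
      (∀ i ∈ Finset.Icc 1 9, i ∉ S → 0 < p.coeff i) := by
  classical
  obtain ⟨D, l, hD, hl, hlen, h0, h8, h9, hsigns⟩ := exists_isEhrhart_hasSigns
    (Nat.ofBits_lt_two_pow fun i : Fin 7 => decide ((i : ℕ) + 1 ∈ S))
  obtain ⟨P, p, hP, hspan, hdeg, hp0, hcount, hcoeff⟩ :=
    hl.exists_polynomial hD h0 hlen h9.ne'
  have hD' : (0 : ℚ) < D := by exact_mod_cast hD
  refine ⟨P, p, hP, hspan, hdeg, hp0, hcount, fun i hi => ?_, fun i hi hiS => ?_⟩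
  · obtain ⟨h1, h7⟩ := Finset.mem_Icc.mp (hS hi)
    obtain ⟨j, rfl⟩ := Nat.exists_eq_add_of_le' h1
    have h := hsigns j (by omega)
    rw [Nat.testBit_ofBits_lt _ _ (by omega), if_pos (decide_eq_true hi)] at h
    rw [hcoeff]
    exact div_neg_of_neg_of_pos (by exact_mod_cast h) hD'
  · rw [hcoeff]
    refine div_pos (Int.cast_pos.mpr ?_) hD'
    obtain ⟨hi1, hi9⟩ := Finset.mem_Icc.mp hi
    obtain ⟨j, rfl⟩ := Nat.exists_eq_add_of_le' hi1
    rcases lt_or_ge j 7 with hj | hj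
    · have h := hsigns j hj
      rwa [Nat.testBit_ofBits_lt _ _ hj, if_neg (by simpa using hiS)] at h
    · obtain rfl | rfl : j = 7 ∨ j = 8 := by omega
      · exact h8
      · exact h9
end
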